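/- arXiv:2408.13350 — 2 statements merged into one kernel-verified Lean document; each statement's English description precedes it below -/
import Mathlib

section
/- Let H be a complex Hilbert space, A ⊆ B(H) a unital C*-subalgebra, X a finite self-adjoint subset of the closed unit ball of A, ε ∈ (0,1/24), and k ≥ 1. Write e = diag(1,0) ∈ M₂(B(H)). Let p ∈ M₂(B(H)) be a projection such that b := p − e belongs to M₂(K(H)) (K(H) the compact operators) and ‖p·diag(x,x) − diag(x,x)·p‖ < ε for all x ∈ X. Let q ∈ M_k(A) be a projection with the property that for every unital C*-algebra C and every unital completely positive (X,ε)-*-homomorphism φ : A → C, the spectrum of the matrix φ(q) ∈ M_k(C) obtained by applying φ entrywise is contained in [0,1/4) ∪ (3/4,1]. Identify M₂(B(H)) ⊗ M_k(ℂ) with M₂(M_k(B(H))) and set s := e⊗1_k + (1₂⊗q)(b⊗1_k)(1₂⊗q), where 1₂⊗q is the block-diagonal amplification of q and b⊗1_k is the entrywise amplification of b. Then s is self-adjoint, 1/2 does not belong to the spectrum of s, the element χ(s) obtained by applying the characteristic function χ of (1/2,∞) to s via the continuous functional calculus is a projection in M₂(M_k(B(H))), and χ(s) − e⊗1_k lies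 in M₂(M_k(K(H))). -/
set_option synthInstance.maxHeartbeats 2000000
set_option maxHeartbeats 4000000

noncomputable section

/-- Finite products of complete spaces are complete; the `PiLp` uniform structure is the
product one.  (This instance is missing from this version of Mathlib.) -/
instance piLpCompleteSpace {ι : Type*} (p : ENNReal) (β : ι → Type*)
    [∀ i, UniformSpace (β i)] [∀ i, CompleteSpace (β i)] :
    CompleteSpace (PiLp p β) :=
  inferInstance

/-- The bounded operator on the Hilbert space `ℓ²(ι; H)` (finite `ι`) induced by a matrix of
bounded operators on `H`.  This realizes the canonical identification of matrices over
`B(H)` with operators, and in particular the unique C*-norm on such matrix algebras. -/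
def matOp {H : Type*} [NormedAddCommGroup H] [InnerProductSpace ℂ H]
    {ι : Type*} [Fintype ι] [DecidableEq ι]
    (m : Matrix ι ι (H →L[ℂ] H)) :
    (PiLp 2 fun _ : ι => H) →L[ℂ] (PiLp 2 fun _ : ι => H) :=
  ((PiLp.continuousLinearEquiv 2 ℂ fun _ : ι => H).symm :
      ((_ : ι) → H) →L[ℂ] PiLp 2 fun _ : ι => H) ∘L
    (ContinuousLinearMap.pi fun i => ∑ j, (m i j) ∘L (ContinuousLinearMap.proj j)) ∘L
    ((PiLp.continuousLinearEquiv 2 ℂ fun _ : ι => H) :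
      (PiLp 2 fun _ : ι => H) →L[ℂ] ((_ : ι) → H))

/-- The matrix `e = diag(1,0) ∈ M₂(B(H))`. -/
def eMat (H : Type*) [NormedAddCommGroup H] [InnerProductSpace ℂ H] [CompleteSpace H] :
    Matrix (Fin 2) (Fin 2) (H →L[ℂ] H) :=
  Matrix.of fun i j => if i = 0 ∧ j = 0 then 1 else 0

/-- The matrix `e ⊗ 1_k ∈ M₂(M_k(B(H)))`. -/
def eMatAmp (H : Type*) [NormedAddCommGroup H] [InnerProductSpace ℂ H] [CompleteSpace H]
    (k : ℕ) : Matrix (Fin 2 × Fin k) (Fin 2 × Fin k) (H →L[ℂ] H) :=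
  Matrix.of fun x y => if x.1 = 0 ∧ y.1 = 0 ∧ x.2 = y.2 then 1 else 0

/-- The amplification `1₂ ⊗ q ∈ M₂(M_k(B(H)))` of a matrix `q ∈ M_k(A)`, via the
representation `ι₀ : A → B(H)`. -/
def qAmp {H : Type*} [NormedAddCommGroup H] [InnerProductSpace ℂ H] [CompleteSpace H]
    {A : Type*} [CStarAlgebra A] (ι₀ : A →⋆ₐ[ℂ] (H →L[ℂ] H)) {k : ℕ}
    (q : Matrix (Fin k) (Fin k) A) :
    Matrix (Fin 2 × Fin k) (Fin 2 × Fin k) (H →L[ℂ] H) :=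
  Matrix.of fun x y => if x.1 = y.1 then ι₀ (q x.2 y.2) else 0

/-- The amplification `b ⊗ 1_k ∈ M₂(M_k(B(H)))` of a matrix `b ∈ M₂(B(H))`. -/
def bAmp {H : Type*} [NormedAddCommGroup H] [InnerProductSpace ℂ H] [CompleteSpace H]
    (b : Matrix (Fin 2) (Fin 2) (H →L[ℂ] H)) (k : ℕ) :
    Matrix (Fin 2 × Fin k) (Fin 2 × Fin k) (H →L[ℂ] H) :=
  Matrix.of fun x y => if x.2 = y.2 then b x.1 y.1 else 0

section MatOp

open ContinuousLinearMap

variable {H : Type*} [NormedAddCommGroup H] [InnerProductSpace ℂ H]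
  {ι : Type*} [Fintype ι] [DecidableEq ι]

lemma matOp_apply (m : Matrix ι ι (H →L[ℂ] H)) (v : PiLp 2 fun _ : ι => H) (i : ι) :
    matOp m v i = ∑ j, m i j (v j) := by
  simp [matOp]

lemma matOp_add (m n : Matrix ι ι (H →L[ℂ] H)) : matOp (m + n) = matOp m + matOp n := by
  ext v i
  simp [matOp_apply, Finset.sum_add_distrib]

lemma matOp_sub (m n : Matrix ι ι (H →L[ℂ] H)) : matOp (m - n) = matOp m - matOp n := by
  ext v i
  simp [matOp_apply, Finset.sum_sub_distrib]

lemma matOp_mul (m n : Matrix ι ι (H →L[ℂ] H)) : matOp (m * n) = matOp m * matOp n := by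
  ext v i
  simp only [matOp_apply, Matrix.mul_apply, mul_apply_eq_comp, sum_apply, map_sum]
  exact Finset.sum_comm

lemma matOp_one : matOp (1 : Matrix ι ι (H →L[ℂ] H)) = 1 := by
  ext v i
  rw [matOp_apply, Finset.sum_eq_single i (fun j _ hj => by simp [hj.symm])
    (by simp)]
  simp

lemma matOp_smul (c : ℂ) (m : Matrix ι ι (H →L[ℂ] H)) : matOp (c • m) = c • matOp m := by
  ext v i
  simp [matOp_apply, Finset.smul_sum]

lemma matOp_injective : Function.Injective (matOp (H := H) (ι := ι)) := by
  intro m n h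
  ext i j x
  have := congrArg (fun T => T (PiLp.single 2 j x) i) h
  simpa [matOp_apply, Pi.single_apply, apply_ite] using this

lemma matOp_surjective : Function.Surjective (matOp (H := H) (ι := ι)) := by
  intro T
  refine ⟨Matrix.of fun i j => PiLp.proj 2 (𝕜 := ℂ) (fun _ : ι => H) i ∘L T ∘L
    ((PiLp.continuousLinearEquiv 2 ℂ fun _ : ι => H).symm : (ι → H) →L[ℂ] _) ∘L
      ContinuousLinearMap.single ℂ (fun _ : ι => H) j, ?_⟩
  ext v i
  have hv : v = ∑ j, PiLp.single 2 j (v j) := by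
    ext l
    simp [Pi.single_apply]
  conv_rhs => rw [hv]
  simp [matOp_apply]

variable [CompleteSpace H]

lemma matOp_star (m : Matrix ι ι (H →L[ℂ] H)) : matOp (star m) = star (matOp m) := by
  rw [star_eq_adjoint, ContinuousLinearMap.eq_adjoint_iff]
  intro x y
  simp only [PiLp.inner_apply, matOp_apply, sum_inner, inner_sum, Matrix.star_apply,
    star_eq_adjoint, ContinuousLinearMap.adjoint_inner_left]
  exact Finset.sum_comm

/-- `matOp` as an isomorphism of `*`-algebras. -/
def matOpEquiv : Matrix ι ι (H →L[ℂ] H) ≃⋆ₐ[ℂ]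
    ((PiLp 2 fun _ : ι => H) →L[ℂ] (PiLp 2 fun _ : ι => H)) where
  __ := Equiv.ofBijective matOp ⟨matOp_injective, matOp_surjective⟩
  map_mul' := matOp_mul
  map_add' := matOp_add
  map_star' := matOp_star
  map_smul' := matOp_smul

omit [CompleteSpace H] in
lemma isCompactOperator_matOp {m : Matrix ι ι (H →L[ℂ] H)}
    (hm : ∀ i j, IsCompactOperator (m i j)) : IsCompactOperator (matOp m) := by
  have key : matOp m = ∑ i, ∑ j,
      (((PiLp.continuousLinearEquiv 2 ℂ fun _ : ι => H).symm : (ι → H) →L[ℂ] _) ∘L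
      ContinuousLinearMap.single ℂ (fun _ : ι => H) i) ∘L m i j ∘L
      PiLp.proj 2 (𝕜 := ℂ) (fun _ : ι => H) j := by
    ext v l
    simp only [matOp_apply, sum_apply, WithLp.ofLp_sum, Finset.sum_apply]
    rw [Finset.sum_comm]
    simp
  rw [key]
  refine Submodule.sum_mem (compactOperator (RingHom.id ℂ) _ _) fun i _ =>
    Submodule.sum_mem _ fun j _ => ?_
  have := ((hm i j).comp_clm (PiLp.proj 2 (𝕜 := ℂ) (fun _ : ι => H) j)).clm_comp
    ((PiLp.continuousLinearEquiv 2 ℂ fun _ : ι => H).symm.toContinuousLinearMap ∘L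
      ContinuousLinearMap.single ℂ (fun _ : ι => H) i)
  exact this

end MatOp

section BoundedBelow

open ContinuousLinearMap

variable {E : Type*} [NormedAddCommGroup E] [InnerProductSpace ℂ E] [CompleteSpace E]

lemma IsSelfAdjoint.isUnit_of_bounded_below {T : E →L[ℂ] E} (hT : IsSelfAdjoint T) {c : ℝ}
    (hc : 0 < c) (h : ∀ v, c * ‖v‖ ≤ ‖T v‖) : IsUnit T := by
  have h2 : IsUnit (T * T) := by
    refine isUnit_of_forall_le_norm_inner_map (T * T) (c := ⟨c ^ 2, by positivity⟩)
      (by change 0 < c ^ 2; positivity) fun x => ?_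
    have : (inner ℂ ((T * T) x) x : ℂ) = (‖T x‖ : ℂ) ^ 2 := by
      rw [mul_apply_eq_comp, ← ContinuousLinearMap.adjoint_inner_right, ← star_eq_adjoint,
        hT.star_eq, inner_self_eq_norm_sq_to_K]
      rfl
    rw [this]
    have h3 := h x
    have : ‖((‖T x‖ : ℂ)) ^ 2‖ = ‖T x‖ ^ 2 := by simp
    rw [this]
    calc ‖x‖ ^ 2 * c ^ 2 = (c * ‖x‖) ^ 2 := by ring
      _ ≤ _ := by gcongr
  exact ((Commute.refl T).isUnit_mul_iff.1 h2).1

lemma IsSelfAdjoint.bounded_below_of_spectrum {T : E →L[ℂ] E} (hT : IsSelfAdjoint T) {c : ℝ}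
    (hc : 0 ≤ c) (h : ∀ r ∈ spectrum ℝ T, c ≤ |r|) (v : E) : c * ‖v‖ ≤ ‖T v‖ := by
  have h1 : 0 ≤ cfc (fun r : ℝ => r ^ 2 - c ^ 2) T := by
    refine cfc_nonneg fun r hr => ?_
    have := h r hr
    rw [← sq_abs r]
    nlinarith
  rw [cfc_sub (fun r : ℝ => r ^ 2) (fun _ => c ^ 2) T, cfc_pow_id T 2, cfc_const (c ^ 2) T] at h1
  have h2 := ((ContinuousLinearMap.nonneg_iff_isPositive _).1 h1).inner_nonneg_left v
  have h3 : (inner ℂ ((T ^ 2) v) v : ℂ) = (‖T v‖ : ℂ) ^ 2 := by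
    rw [pow_two, mul_apply_eq_comp, ← ContinuousLinearMap.adjoint_inner_right, ← star_eq_adjoint,
      hT.star_eq, inner_self_eq_norm_sq_to_K]
    rfl
  have h4 : (inner ℂ ((algebraMap ℝ (E →L[ℂ] E) (c ^ 2)) v) v : ℂ) = ((c * ‖v‖ : ℝ) : ℂ) ^ 2 := by
    rw [Algebra.algebraMap_eq_smul_one]
    simp [inner_self_eq_norm_sq_to_K]
    ring
  rw [sub_apply, inner_sub_left, h3, h4] at h2
  have h5 : 0 ≤ ‖T v‖ ^ 2 - (c * ‖v‖) ^ 2 := by exact_mod_cast h2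
  exact le_of_sq_le_sq (by linarith) (norm_nonneg _)

omit [CompleteSpace E] in
lemma algebraMap_real_apply (a : ℝ) (v : E) :
    algebraMap ℝ (E →L[ℂ] E) a v = (a : ℂ) • v := by
  rw [Algebra.algebraMap_eq_smul_one]
  simp

lemma IsSelfAdjoint.norm_sub_smul_ge {T : E →L[ℂ] E} (hT : IsSelfAdjoint T) {a c : ℝ}
    (hc : 0 ≤ c) (h : ∀ r ∈ spectrum ℝ T, c ≤ |r - a|) (v : E) :
    c * ‖v‖ ≤ ‖T v - (a : ℂ) • v‖ := by
  have hsa : IsSelfAdjoint (T - algebraMap ℝ _ a) := by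
    refine IsSelfAdjoint.sub hT ?_
    exact IsSelfAdjoint.algebraMap _ (.all a)
  have := hsa.bounded_below_of_spectrum hc (fun s hs => by
    rw [← spectrum.sub_singleton_eq] at hs
    obtain ⟨r, hr, b, rfl, rfl⟩ := Set.mem_sub.1 hs
    exact h r hr) v
  rwa [sub_apply, algebraMap_real_apply] at this

lemma IsSelfAdjoint.notMem_spectrum_of_bounded_below {T : E →L[ℂ] E} (hT : IsSelfAdjoint T)
    {a c : ℝ} (hc : 0 < c) (h : ∀ v, c * ‖v‖ ≤ ‖T v - (a : ℂ) • v‖) : a ∉ spectrum ℝ T := by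
  rw [spectrum.notMem_iff, ← IsUnit.neg_iff, neg_sub]
  have hsa : IsSelfAdjoint (T - algebraMap ℝ _ a) := by
    refine IsSelfAdjoint.sub hT ?_
    exact IsSelfAdjoint.algebraMap _ (.all a)
  refine hsa.isUnit_of_bounded_below hc fun v => ?_
  rw [sub_apply, algebraMap_real_apply]
  exact h v

end BoundedBelow

section CFC

variable {E : Type*} [NormedAddCommGroup E] [InnerProductSpace ℂ E] [CompleteSpace E]

omit [CompleteSpace E] in
open Polynomial in
lemma isCompactOperator_aeval_sub {S T : E →L[ℂ] E} (h : IsCompactOperator (S - T))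
    (f : ℝ[X]) : IsCompactOperator (aeval S f - aeval T f) := by
  induction f using Polynomial.induction_on' with
  | add f g hf hg =>
    have := hf.add hg
    rw [map_add, map_add, add_sub_add_comm]
    exact this
  | monomial n a =>
    simp only [aeval_monomial, Algebra.algebraMap_eq_smul_one, smul_mul_assoc, one_mul,
      ← smul_sub]
    refine IsCompactOperator.smul (S := ℝ) ?_ a
    induction n with
    | zero =>
      rw [pow_zero, pow_zero, sub_self]
      exact isCompactOperator_zero
    | succ n ih =>
      have e : S ^ (n + 1) - T ^ (n + 1) = S ^ n * (S - T) + (S ^ n - T ^ n) * T := by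
        rw [pow_succ, pow_succ]; noncomm_ring
      rw [e]
      exact (h.clm_comp (S ^ n)).add (ih.comp_clm T)

lemma isCompactOperator_cfc_sub_cfc {S T : E →L[ℂ] E} (hS : IsSelfAdjoint S)
    (hT : IsSelfAdjoint T) (h : IsCompactOperator (S - T)) {f : ℝ → ℝ} (hf : Continuous f) :
    IsCompactOperator (cfc f S - cfc f T) := by
  have hmem : cfc f S - cfc f T ∈ closure {R : E →L[ℂ] E | IsCompactOperator R} := by
    rw [Metric.mem_closure_iff]
    intro ε hε
    obtain ⟨M, hM⟩ : ∃ M : ℝ, ∀ r ∈ spectrum ℝ S ∪ spectrum ℝ T, r ∈ Set.Icc (-M) M := by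
      obtain ⟨M, hM⟩ := ((spectrum.isBounded (𝕜 := ℝ) S).union
        (spectrum.isBounded (𝕜 := ℝ) T)).exists_norm_le
      exact ⟨M, fun r hr => abs_le.1 (hM r hr)⟩
    obtain ⟨g, hg⟩ := exists_polynomial_near_of_continuousOn (-M) M f hf.continuousOn (ε / 3)
      (by positivity)
    refine ⟨_, isCompactOperator_aeval_sub h g, ?_⟩
    have hb : ∀ R : E →L[ℂ] E, IsSelfAdjoint R → (∀ r ∈ spectrum ℝ R, r ∈ Set.Icc (-M) M) →
        ‖cfc f R - Polynomial.aeval R g‖ ≤ ε / 3 := by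
      intro R hR hRM
      rw [← cfc_polynomial g R, ← cfc_sub f g.eval R]
      refine norm_cfc_le (by positivity) fun r hr => ?_
      rw [Real.norm_eq_abs, abs_sub_comm]
      exact (hg r (hRM r hr)).le
    have h1 := hb S hS fun r hr => hM r (.inl hr)
    have h2 := hb T hT fun r hr => hM r (.inr hr)
    rw [dist_eq_norm]
    calc _ = ‖(cfc f S - Polynomial.aeval S g) - (cfc f T - Polynomial.aeval T g)‖ := by
          congr 1; abel
      _ ≤ ε / 3 + ε / 3 := (norm_sub_le _ _).trans (add_le_add h1 h2)
      _ < ε := by linarith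
  rwa [(isClosed_setOfPred_isCompactOperator).closure_eq] at hmem

end CFC

section Compression

open ContinuousLinearMap

variable {L : Type*} [NormedAddCommGroup L] [InnerProductSpace ℂ L] [CompleteSpace L]
  {K : Type*} [NormedAddCommGroup K] [InnerProductSpace ℂ K] [CompleteSpace K]

lemma adjoint_apply_eq_of_comp_eq {P : K →L[ℂ] K} (hP : IsSelfAdjoint P) {V : L →L[ℂ] K}
    (hPV : ∀ v, P (V v) = V v) (z : K) : adjoint V (P z) = adjoint V z := by
  refine ext_inner_right ℂ fun v => ?_
  rw [adjoint_inner_left, adjoint_inner_left, ← adjoint_inner_right, ← star_eq_adjoint,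
    hP.star_eq, hPV]

lemma norm_adjoint_isometry_apply_le {V : L →L[ℂ] K} (hV : ∀ v, ‖V v‖ = ‖v‖) (z : K) :
    ‖adjoint V z‖ ≤ ‖z‖ := by
  refine ((adjoint V).le_of_opNorm_le (c := 1) ?_ z).trans_eq (one_mul _)
  rw [LinearIsometryEquiv.norm_map]
  exact V.opNorm_le_bound zero_le_one fun v => by rw [hV, one_mul]

lemma adjoint_isometry_apply (V : L →ₗᵢ[ℂ] K) (v : L) :
    adjoint V.toContinuousLinearMap (V v) = v := by
  refine ext_inner_right ℂ fun w => ?_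
  rw [adjoint_inner_left]
  exact V.inner_map_map v w

lemma norm_gap_of_compression {P Q : K →L[ℂ] K} (hP : IsSelfAdjoint P)
    (hQ : IsSelfAdjoint Q) {U : L →ₗᵢ[ℂ] K} (hPU : ∀ v, P (U v) = U v) {a c : ℝ} (hc : 0 ≤ c)
    (hspec : ∀ r ∈ spectrum ℝ (adjoint U.toContinuousLinearMap ∘L Q ∘L U.toContinuousLinearMap),
      c ≤ |r - a|) (v : L) :
    c * ‖U v‖ ≤ ‖P (Q (U v)) - (a : ℂ) • U v‖ := by
  set V := U.toContinuousLinearMap with hV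
  have hT : IsSelfAdjoint (adjoint V ∘L Q ∘L V) := hQ.adjoint_conj V
  have hTv : (adjoint V ∘L Q ∘L V) v - (a : ℂ) • v =
      adjoint V (P (Q (U v)) - (a : ℂ) • U v) := by
    rw [map_sub, map_smul, adjoint_apply_eq_of_comp_eq hP (V := V) hPU, adjoint_isometry_apply]
    rfl
  have h := hT.norm_sub_smul_ge hc hspec v
  rw [hTv] at h
  rw [U.norm_map]
  exact h.trans (norm_adjoint_isometry_apply_le (V := V) U.norm_map _)

end Compression

section Projections

variable {E : Type*} [NormedAddCommGroup E] [InnerProductSpace ℂ E] [CompleteSpace E]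

lemma IsStarProjection.norm_apply_le {P : E →L[ℂ] E} (hP : IsStarProjection P) (v : E) :
    ‖P v‖ ≤ ‖v‖ :=
  (P.le_of_opNorm_le hP.norm_le v).trans_eq (one_mul _)

lemma isSelfAdjoint_add_conj {P Q e : E →L[ℂ] E} (hP : IsStarProjection P)
    (hQ : IsStarProjection Q) (he : IsStarProjection e) :
    IsSelfAdjoint (e + Q * (P - e) * Q) := by
  have h1 : IsSelfAdjoint (P - e) := IsSelfAdjoint.sub hP.isSelfAdjoint he.isSelfAdjoint
  exact IsSelfAdjoint.add he.isSelfAdjoint (h1.conjugate_self hQ.isSelfAdjoint)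

lemma bounded_below_of_gap {P Q e : E →L[ℂ] E} (hP : IsStarProjection P)
    (hQ : IsStarProjection Q) (he : IsStarProjection e) (heQ : e * Q = Q * e)
    (hgap : ∀ t, P t = t → (1 / 4) * ‖t‖ ≤ ‖P (Q t) - (1 / 2 : ℂ) • t‖) (v : E) :
    (1 / 16) * ‖v‖ ≤ ‖(e + Q * (P - e) * Q) v - (1 / 2 : ℂ) • v‖ := by
  have hPP : ∀ x, P (P x) = P x := fun x => congrArg (fun T => T x) hP.isIdempotentElem.eq
  have hQQ : ∀ x, Q (Q x) = Q x := fun x => congrArg (fun T => T x) hQ.isIdempotentElem.eq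
  have hee : ∀ x, e (e x) = e x := fun x => congrArg (fun T => T x) he.isIdempotentElem.eq
  have hQe : ∀ x, e (Q x) = Q (e x) := fun x => congrArg (fun T => T x) heQ
  set y := (e + Q * (P - e) * Q) v - (1 / 2 : ℂ) • v with hy
  have hy' : y = e v + (Q (P (Q v)) - Q (e v)) - (1 / 2 : ℂ) • v := by
    simp [hy, hQe, hQQ]
  have hQy : Q y = Q (P (Q v)) - (1 / 2 : ℂ) • Q v := by
    simp [hy', hQQ]
  have hw : y - Q y = e (v - Q v) - (1 / 2 : ℂ) • (v - Q v) := by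
    rw [hQy, hy', map_sub, hQe]
    module
  have h1 : ‖v - Q v‖ ≤ 6 * ‖y - Q y‖ := by
    have : v - Q v = (4 : ℂ) • e (y - Q y) - (2 : ℂ) • (y - Q y) := by
      rw [hw, map_sub, hee, map_smul]
      module
    calc ‖v - Q v‖ ≤ ‖(4 : ℂ) • e (y - Q y)‖ + ‖(2 : ℂ) • (y - Q y)‖ := by
          rw [this]; exact norm_sub_le _ _
      _ = 4 * ‖e (y - Q y)‖ + 2 * ‖y - Q y‖ := by simp [norm_smul]
      _ ≤ _ := by linarith [he.norm_apply_le (y - Q y)]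
  have h2 : ‖y - Q y‖ ≤ ‖y‖ := hQ.one_sub.norm_apply_le y
  have h3 : ‖Q y‖ ≤ ‖y‖ := hQ.norm_apply_le y
  have h4 : (1 / 4) * ‖P (Q v)‖ ≤ ‖Q y‖ := by
    refine (hgap _ (hPP _)).trans ?_
    rw [← map_smul, ← map_sub, ← hQy]
    exact hP.norm_apply_le _
  have h5 : (1 / 2) * ‖Q v‖ ≤ ‖P (Q v)‖ + ‖Q y‖ := by
    have : (1 / 2 : ℂ) • Q v = Q (P (Q v)) - Q y := by rw [hQy]; abel
    calc (1 / 2) * ‖Q v‖ = ‖(1 / 2 : ℂ) • Q v‖ := by simp [norm_smul]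
      _ ≤ ‖Q (P (Q v))‖ + ‖Q y‖ := by rw [this]; exact norm_sub_le _ _
      _ ≤ _ := by gcongr; exact hQ.norm_apply_le _
  have h6 : ‖v‖ ≤ ‖v - Q v‖ + ‖Q v‖ := norm_le_norm_sub_add v (Q v)
  linarith

lemma cfc_indicator_of_compact_sub {S e : E →L[ℂ] E} (hS : IsSelfAdjoint S)
    (he : IsStarProjection e) (hspec : (1 / 2 : ℝ) ∉ spectrum ℝ S)
    (hc : IsCompactOperator (S - e)) :
    IsSelfAdjoint (cfc (fun r : ℝ => if 1 / 2 < r then (1 : ℝ) else 0) S) ∧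
    IsIdempotentElem (cfc (fun r : ℝ => if 1 / 2 < r then (1 : ℝ) else 0) S) ∧
    IsCompactOperator (cfc (fun r : ℝ => if 1 / 2 < r then (1 : ℝ) else 0) S - e) := by
  obtain ⟨η, hη, hball⟩ := Metric.isOpen_iff.1 (spectrum.isClosed (𝕜 := ℝ) S).isOpen_compl _ hspec
  obtain ⟨δ, hδ, hδη, hδ'⟩ : ∃ δ : ℝ, 0 < δ ∧ δ ≤ η ∧ δ ≤ 1 / 2 :=
    ⟨min η (1 / 2), by positivity, min_le_left _ _, min_le_right _ _⟩
  let g : ℝ → ℝ := fun r => max 0 (min 1 ((r - 1 / 2) / (2 * δ) + 1 / 2))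
  have hg : Continuous g := by fun_prop
  have hg1 : ∀ r, 1 / 2 + δ ≤ r → g r = 1 := by
    intro r hr
    have : 1 ≤ (r - 1 / 2) / (2 * δ) + 1 / 2 := by
      have : 1 / 2 ≤ (r - 1 / 2) / (2 * δ) := by rw [le_div_iff₀ (by positivity)]; linarith
      linarith
    simp only [g, min_eq_left this]
    norm_num
  have hg0 : ∀ r, r ≤ 1 / 2 - δ → g r = 0 := by
    intro r hr
    have : (r - 1 / 2) / (2 * δ) + 1 / 2 ≤ 0 := by
      have : (r - 1 / 2) / (2 * δ) ≤ -(1 / 2) := by rw [div_le_iff₀ (by positivity)]; linarith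
      linarith
    exact max_eq_left ((min_le_right _ _).trans this)
  have hSg : (spectrum ℝ S).EqOn (fun r : ℝ => if 1 / 2 < r then (1 : ℝ) else 0) g := by
    intro r hr
    have hd : η ≤ |r - 1 / 2| := by
      by_contra! h
      exact hball (by rwa [Metric.mem_ball, Real.dist_eq]) hr
    by_cases h : 1 / 2 < r
    · rw [abs_of_pos (by linarith)] at hd
      simp only [h, if_true, hg1 r (by linarith)]
    · rw [abs_of_nonpos (by linarith)] at hd
      simp only [h, if_false, hg0 r (by linarith)]
  have heg : cfc g e = e := by
    refine (cfc_congr fun r hr => ?_).trans (cfc_id ℝ e he.isSelfAdjoint)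
    rcases he.isIdempotentElem.spectrum_subset ℝ hr with rfl | rfl
    · exact hg0 0 (by linarith)
    · exact hg1 1 (by linarith)
  rw [cfc_congr hSg]
  refine ⟨cfc_predicate g S, ?_, ?_⟩
  · rw [IsIdempotentElem, ← cfc_mul g g S hg.continuousOn hg.continuousOn]
    refine cfc_congr fun r hr => ?_
    simp only [← hSg hr]
    split_ifs <;> simp
  · have := isCompactOperator_cfc_sub_cfc hS he.isSelfAdjoint hc hg
    rwa [heg] at this

end Projections

section SmallSubspace

lemma countable_submonoidClosure {M : Type*} [Monoid M] {S : Set M} (hS : S.Countable) :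
    (Submonoid.closure S : Set M).Countable := by
  have := hS.to_subtype
  have : Countable (FreeMonoid S) := inferInstanceAs (Countable (List S))
  rw [Submonoid.closure_eq_mrange, MonoidHom.coe_mrange]
  exact Set.countable_range _

lemma Orthonormal.countable {E ι : Type*} [NormedAddCommGroup E] [InnerProductSpace ℂ E]
    [TopologicalSpace.SeparableSpace E] {v : ι → E} (hv : Orthonormal ℂ v) : Countable ι := by
  refine Pairwise.countable_of_isOpen_disjoint (s := fun i => Metric.ball (v i) (1 / 2))
    (fun i j hij => ?_) (fun _ => Metric.isOpen_ball) (fun i => ⟨v i, by simp⟩)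
  refine Metric.ball_disjoint_ball ?_
  have h : ‖v i - v j‖ * ‖v i - v j‖ = 2 := by
    rw [norm_sub_mul_self (𝕜 := ℂ), hv.2 hij, hv.1 i, hv.1 j]
    norm_num
  rw [dist_eq_norm]
  nlinarith [norm_nonneg (v i - v j)]

/-- Countably many operators and vectors are contained in a separable invariant subspace, which
is the range of an isometry defined on an `ℓ²`-space in an arbitrary universe. -/
lemma exists_isometry_small.{u} {K : Type*} [NormedAddCommGroup K] [InnerProductSpace ℂ K]
    [CompleteSpace K] {S : Set (K →L[ℂ] K)} (hS : S.Countable) {κ : Type*} [Countable κ]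
    (τ : κ → K) {p : K →L[ℂ] K} (hpτ : ∀ i, p (τ i) = τ i) (hpS : ∀ g ∈ S, p * g = g) :
    ∃ (ι : Type u) (W : lp (fun _ : ι => ℂ) 2 →ₗᵢ[ℂ] K), (∀ i, τ i ∈ Set.range W) ∧
      (∀ g ∈ S, ∀ v, g (W v) ∈ Set.range W) ∧ ∀ v, p (W v) = W v := by
  have hN := (countable_submonoidClosure hS).to_subtype
  set D : Set K := Set.range fun x : (Submonoid.closure S) × κ => (x.1 : K →L[ℂ] K) (τ x.2)
    with hD
  set L := (Submodule.span ℂ D).topologicalClosure with hL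
  have hDc : D.Countable := Set.countable_range _
  have hLs : TopologicalSpace.IsSeparable (L : Set K) := by
    rw [hL, Submodule.topologicalClosure_coe]
    exact hDc.isSeparable.span.closure
  have hsep : TopologicalSpace.SeparableSpace L := hLs.separableSpace
  have hcomp : CompleteSpace L := (Submodule.isClosed_topologicalClosure _).completeSpace_coe
  obtain ⟨w, b, -⟩ := exists_hilbertBasis ℂ L
  have hw : Countable w := b.orthonormal.countable
  let e := (equivShrink.{u} w).symm
  have hv : Orthonormal ℂ (b ∘ e) := b.orthonormal.comp e e.injective
  let B : HilbertBasis (Shrink.{u} w) ℂ L := HilbertBasis.mk hv (by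
    rw [Set.range_comp, e.surjective.range_eq, Set.image_univ, b.dense_span])
  have hDL : ∀ x ∈ D, x ∈ L := fun x hx =>
    Submodule.le_topologicalClosure _ (Submodule.subset_span hx)
  have hLB : ∀ x ∈ L, x ∈ Set.range (L.subtypeₗᵢ.comp B.repr.symm.toLinearIsometry) :=
    fun x hx => ⟨B.repr ⟨x, hx⟩, by simp⟩
  refine ⟨_, L.subtypeₗᵢ.comp B.repr.symm.toLinearIsometry, fun i => hLB _ (hDL _ ?_),
    fun g hg v => hLB _ ?_, fun v => ?_⟩
  · exact ⟨(1, i), by simp⟩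
  · have hgL : L ≤ L.comap (g : K →ₗ[ℂ] K) := by
      refine Submodule.topologicalClosure_minimal _ (Submodule.span_le.2 ?_)
        ((Submodule.isClosed_topologicalClosure _).preimage g.continuous)
      rintro _ ⟨⟨h, i⟩, rfl⟩
      exact hDL _ ⟨(⟨g, Submonoid.subset_closure hg⟩ * h, i), by simp⟩
    exact hgL (B.repr.symm v).2
  · have hpL : L ≤ (p - 1 : K →L[ℂ] K).ker := by
      refine Submodule.topologicalClosure_minimal _ (Submodule.span_le.2 ?_)
        (p - 1 : K →L[ℂ] K).isClosed_ker
      rintro _ ⟨⟨⟨h, hh⟩, i⟩, rfl⟩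
      suffices p (h (τ i)) = h (τ i) by simpa [sub_eq_zero] using this
      induction hh using Submonoid.closure_induction_left with
      | one => simpa using hpτ i
      | mul_left g hg y hy _ =>
        have := congrArg (fun T => T (y (τ i))) (hpS g hg)
        simpa using this
    have := hpL (B.repr.symm v).2
    simpa [sub_eq_zero] using this

end SmallSubspace

section Amplification

open ContinuousLinearMap

variable {H : Type*} [NormedAddCommGroup H] [InnerProductSpace ℂ H] [CompleteSpace H]
  {A : Type*} [CStarAlgebra A] (ι₀ : A →⋆ₐ[ℂ] (H →L[ℂ] H))

lemma qAmp_mul {k : ℕ} (y z : Matrix (Fin k) (Fin k) A) :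
    qAmp ι₀ (y * z) = qAmp ι₀ y * qAmp ι₀ z := by
  ext1 ⟨a, i⟩ ⟨b, j⟩
  simp only [qAmp, Matrix.of_apply, Matrix.mul_apply, map_sum, map_mul, Fintype.sum_prod_type,
    ite_mul, zero_mul, mul_ite, mul_zero]
  rw [Finset.sum_eq_single a (fun c _ hc => by simp [hc.symm]) (by simp)]
  by_cases h : a = b <;> simp [h]

lemma qAmp_star {k : ℕ} (y : Matrix (Fin k) (Fin k) A) :
    qAmp ι₀ (star y) = star (qAmp ι₀ y) := by
  ext1 ⟨a, i⟩ ⟨b, j⟩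
  simp only [qAmp, Matrix.of_apply, Matrix.star_apply, map_star]
  by_cases h : a = b
  · simp [h]
  · simp [h, Ne.symm h]

lemma bAmp_mul {k : ℕ} (y z : Matrix (Fin 2) (Fin 2) (H →L[ℂ] H)) :
    bAmp (y * z) k = bAmp y k * bAmp z k := by
  ext1 ⟨a, i⟩ ⟨b, j⟩
  simp only [bAmp, Matrix.of_apply, Matrix.mul_apply, Fintype.sum_prod_type_right,
    ite_mul, zero_mul, mul_ite, mul_zero]
  rw [Finset.sum_eq_single i (fun c _ hc => by simp [hc.symm]) (by simp)]
  by_cases h : i = j <;> simp [h]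

lemma bAmp_star {k : ℕ} (y : Matrix (Fin 2) (Fin 2) (H →L[ℂ] H)) :
    bAmp (star y) k = star (bAmp y k) := by
  ext1 ⟨a, i⟩ ⟨b, j⟩
  simp only [bAmp, Matrix.of_apply, Matrix.star_apply]
  by_cases h : i = j
  · simp [h]
  · simp [h, Ne.symm h]

lemma bAmp_sub {k : ℕ} (y z : Matrix (Fin 2) (Fin 2) (H →L[ℂ] H)) :
    bAmp (y - z) k = bAmp y k - bAmp z k := by
  ext1 ⟨a, i⟩ ⟨b, j⟩
  simp only [bAmp, Matrix.of_apply, Matrix.sub_apply]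
  split_ifs <;> simp

lemma eMatAmp_eq_bAmp (k : ℕ) : eMatAmp H k = bAmp (eMat H) k := by
  ext1 ⟨a, i⟩ ⟨b, j⟩
  simp only [eMatAmp, bAmp, eMat, Matrix.of_apply]
  split_ifs <;> simp_all

lemma eMat_star : star (eMat H) = eMat H := by
  ext1 a b
  simp only [eMat, Matrix.of_apply, Matrix.star_apply, and_comm]
  split_ifs <;> simp

lemma eMat_mul_self : eMat H * eMat H = eMat H := by
  ext1 a b
  fin_cases a <;> fin_cases b <;> simp [eMat, Matrix.mul_apply]

lemma eMatAmp_commute_qAmp {k : ℕ} (q : Matrix (Fin k) (Fin k) A) :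
    eMatAmp H k * qAmp ι₀ q = qAmp ι₀ q * eMatAmp H k := by
  ext1 ⟨a, i⟩ ⟨b, j⟩
  fin_cases a <;> fin_cases b <;>
    simp [eMatAmp, qAmp, Matrix.mul_apply, Fintype.sum_prod_type]

lemma matOp_bAmp_apply {k : ℕ} (y : Matrix (Fin 2) (Fin 2) (H →L[ℂ] H))
    (v : PiLp 2 fun _ : Fin 2 × Fin k => H) (a : Fin 2) (i : Fin k) :
    matOp (bAmp y k) v (a, i) = matOp y (WithLp.toLp 2 fun b => v (b, i)) a := by
  simp only [matOp_apply, bAmp, Matrix.of_apply, Fintype.sum_prod_type_right]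
  rw [Finset.sum_eq_single i (fun c _ hc => by simp [hc.symm]) (by simp)]
  simp

/-- The diagonal representation `a ↦ diag(a, a)`. -/
def diagHom : A →⋆ₐ[ℂ] ((PiLp 2 fun _ : Fin 2 => H) →L[ℂ] (PiLp 2 fun _ : Fin 2 => H)) where
  toFun a := matOp (Matrix.diagonal fun _ : Fin 2 => ι₀ a)
  map_one' := by simp only [map_one, Matrix.diagonal_one, matOp_one]
  map_mul' a b := by rw [← matOp_mul, Matrix.diagonal_mul_diagonal]; simp only [map_mul]
  map_zero' := by ext v i; simp [matOp_apply]
  map_add' a b := by rw [← matOp_add, Matrix.diagonal_add]; simp only [map_add]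
  commutes' c := by
    rw [Algebra.algebraMap_eq_smul_one, Algebra.algebraMap_eq_smul_one, ← matOp_one, ← matOp_smul]
    congr 1
    ext1 i j
    by_cases h : i = j <;> simp [h]
  map_star' a := by
    rw [← matOp_star, Matrix.star_eq_conjTranspose, Matrix.diagonal_conjTranspose]
    congr 2
    ext1 i
    exact map_star ι₀ a

lemma diagHom_apply (a : A) :
    diagHom ι₀ a = matOp (Matrix.diagonal fun _ : Fin 2 => ι₀ a) := rfl

lemma diagHom_apply_apply (a : A) (v : PiLp 2 fun _ : Fin 2 => H) (i : Fin 2) :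
    diagHom ι₀ a v i = ι₀ a (v i) := by
  rw [diagHom_apply, matOp_apply,
    Finset.sum_eq_single i (fun j _ hj => by simp [hj.symm]) (by simp)]
  simp

variable {L : Type*} [NormedAddCommGroup L] [InnerProductSpace ℂ L] [CompleteSpace L]

/-- The compression `a ↦ W* diag(a, a) W` of the diagonal representation. -/
def compr (W : L →L[ℂ] PiLp 2 fun _ : Fin 2 => H) : A →ₗ[ℂ] (L →L[ℂ] L) where
  toFun a := adjoint W ∘L diagHom ι₀ a ∘L W
  map_add' a b := by ext v; simp
  map_smul' c a := by ext v; simp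

/-- The entrywise amplification of an operator `W : L → H²`. -/
def ampl (W : L →L[ℂ] PiLp 2 fun _ : Fin 2 => H) (k : ℕ) :
    (PiLp 2 fun _ : Fin k => L) →L[ℂ] PiLp 2 fun _ : Fin 2 × Fin k => H :=
  ((PiLp.continuousLinearEquiv 2 ℂ fun _ : Fin 2 × Fin k => H).symm :
      (Fin 2 × Fin k → H) →L[ℂ] PiLp 2 fun _ : Fin 2 × Fin k => H) ∘L
    (ContinuousLinearMap.pi fun x =>
      PiLp.proj 2 (𝕜 := ℂ) (fun _ : Fin 2 => H) x.1 ∘L W ∘L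
        PiLp.proj 2 (𝕜 := ℂ) (fun _ : Fin k => L) x.2)

omit [CompleteSpace H] [CompleteSpace L] in
lemma ampl_apply (W : L →L[ℂ] PiLp 2 fun _ : Fin 2 => H) {k : ℕ}
    (r : PiLp 2 fun _ : Fin k => L) (x : Fin 2 × Fin k) : ampl W k r x = W (r x.2) x.1 := rfl

omit [CompleteSpace H] [CompleteSpace L] in
lemma norm_ampl (W : L →ₗᵢ[ℂ] PiLp 2 fun _ : Fin 2 => H) {k : ℕ}
    (r : PiLp 2 fun _ : Fin k => L) : ‖ampl W.toContinuousLinearMap k r‖ = ‖r‖ := by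
  rw [← sq_eq_sq₀ (norm_nonneg _) (norm_nonneg _), PiLp.norm_sq_eq_of_L2, PiLp.norm_sq_eq_of_L2,
    Fintype.sum_prod_type_right]
  refine Finset.sum_congr rfl fun i _ => ?_
  rw [← W.norm_map (r i), PiLp.norm_sq_eq_of_L2]
  rfl

/-- The entrywise amplification of an isometry `W : L → H²`, as an isometry. -/
def amplIsometry (W : L →ₗᵢ[ℂ] PiLp 2 fun _ : Fin 2 => H) (k : ℕ) :
    (PiLp 2 fun _ : Fin k => L) →ₗᵢ[ℂ] PiLp 2 fun _ : Fin 2 × Fin k => H :=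
  ⟨(ampl W.toContinuousLinearMap k).toLinearMap, norm_ampl W⟩

omit [CompleteSpace H] [CompleteSpace L] in
lemma amplIsometry_toContinuousLinearMap (W : L →ₗᵢ[ℂ] PiLp 2 fun _ : Fin 2 => H) (k : ℕ) :
    (amplIsometry W k).toContinuousLinearMap = ampl W.toContinuousLinearMap k := rfl

lemma matOp_map_compr (W : L →L[ℂ] PiLp 2 fun _ : Fin 2 => H) {k : ℕ}
    (m : Matrix (Fin k) (Fin k) A) :
    matOp (m.map (compr ι₀ W)) = adjoint (ampl W k) ∘L matOp (qAmp ι₀ m) ∘L ampl W k := by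
  ext1 r
  refine ext_inner_right ℂ fun r' => ?_
  simp only [coe_comp, Function.comp_apply, adjoint_inner_left, PiLp.inner_apply, matOp_apply,
    sum_inner, Matrix.map_apply, Fintype.sum_prod_type_right, ampl_apply, qAmp, Matrix.of_apply]
  refine Finset.sum_congr rfl fun i _ => ?_
  rw [Finset.sum_comm]
  refine Finset.sum_congr rfl fun j _ => ?_
  have : ∀ a : Fin 2, ∑ c : Fin 2, (inner ℂ ((if a = c then ι₀ (m i j) else 0)
      ((W (r j)) c)) ((W (r' i)) a) : ℂ) = inner ℂ (ι₀ (m i j) ((W (r j)) a)) ((W (r' i)) a) := by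
    intro a
    rw [Finset.sum_eq_single a (fun c _ hc => by simp [hc.symm]) (by simp)]
    simp
  simp only [this]
  change (inner ℂ (adjoint W (diagHom ι₀ (m i j) (W (r j)))) (r' i) : ℂ) = _
  rw [adjoint_inner_left, PiLp.inner_apply]
  simp only [diagHom_apply_apply]

lemma compr_completelyPositive (W : L →L[ℂ] PiLp 2 fun _ : Fin 2 => H) {j : ℕ}
    (y : Matrix (Fin j) (Fin j) A) :
    ∃ z : Matrix (Fin j) (Fin j) (L →L[ℂ] L), (star y * y).map (compr ι₀ W) = star z * z := by
  have hpos : 0 ≤ matOp ((star y * y).map (compr ι₀ W)) := by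
    rw [ContinuousLinearMap.nonneg_iff_isPositive, matOp_map_compr, qAmp_mul, qAmp_star,
      matOp_mul, matOp_star]
    exact IsPositive.adjoint_conj
      (isPositive_adjoint_comp_self (matOp (qAmp ι₀ y))) (ampl W j)
  obtain ⟨z, hz⟩ := CStarAlgebra.nonneg_iff_eq_star_mul_self.1 hpos
  obtain ⟨z, rfl⟩ := matOp_surjective z
  exact ⟨z, matOp_injective (by rw [hz, matOp_mul, matOp_star])⟩

end Amplification

section Gap

open ContinuousLinearMap

variable {H : Type*} [NormedAddCommGroup H] [InnerProductSpace ℂ H] [CompleteSpace H]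
  {A : Type*} [CStarAlgebra A] (ι₀ : A →⋆ₐ[ℂ] (H →L[ℂ] H))

lemma isStarProjection_matOp {ι : Type*} [Fintype ι] [DecidableEq ι]
    {m : Matrix ι ι (H →L[ℂ] H)} (hm : m * m = m) (hm' : star m = m) :
    IsStarProjection (matOp m) :=
  ⟨by rw [IsIdempotentElem, ← matOp_mul, hm], by rw [IsSelfAdjoint, ← matOp_star, hm']⟩

variable {L : Type*} [NormedAddCommGroup L] [InnerProductSpace ℂ L] [CompleteSpace L]

lemma compr_one (W : L →ₗᵢ[ℂ] PiLp 2 fun _ : Fin 2 => H) :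
    compr ι₀ W.toContinuousLinearMap 1 = 1 := by
  ext1 v
  change adjoint W.toContinuousLinearMap (diagHom ι₀ 1 (W v)) = v
  rw [map_one]
  exact adjoint_isometry_apply W v

lemma compr_star (W : L →L[ℂ] PiLp 2 fun _ : Fin 2 => H) (a : A) :
    compr ι₀ W (star a) = star (compr ι₀ W a) := by
  change adjoint W ∘L diagHom ι₀ (star a) ∘L W = adjoint (adjoint W ∘L diagHom ι₀ a ∘L W)
  rw [map_star, star_eq_adjoint, adjoint_comp, adjoint_comp, adjoint_adjoint]
  rfl

lemma norm_compr_mul_sub_le {P : (PiLp 2 fun _ : Fin 2 => H) →L[ℂ] (PiLp 2 fun _ : Fin 2 => H)}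
    (hP : IsSelfAdjoint P) {W : L →ₗᵢ[ℂ] PiLp 2 fun _ : Fin 2 => H}
    (hPW : ∀ v, P (W v) = W v) (x : A) {y : A}
    (hy : ∀ v, P (diagHom ι₀ y (W v)) ∈ Set.range W) :
    ‖compr ι₀ W.toContinuousLinearMap (x * y) -
      compr ι₀ W.toContinuousLinearMap x * compr ι₀ W.toContinuousLinearMap y‖ ≤
    ‖P * diagHom ι₀ x - diagHom ι₀ x * P‖ * ‖y‖ := by
  refine opNorm_le_bound _ (by positivity) fun v => ?_
  set W' := W.toContinuousLinearMap with hW'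
  have hadj : ∀ z, adjoint W' (P z) = adjoint W' z :=
    adjoint_apply_eq_of_comp_eq hP (V := W') hPW
  obtain ⟨u, hu⟩ := hy v
  have hu' : adjoint W' (diagHom ι₀ y (W v)) = u := by
    rw [← hadj, ← hu]
    exact adjoint_isometry_apply W u
  have key : (compr ι₀ W' (x * y) - compr ι₀ W' x * compr ι₀ W' y) v =
      adjoint W' ((P * diagHom ι₀ x - diagHom ι₀ x * P) (diagHom ι₀ y (W v))) := by
    change adjoint W' (diagHom ι₀ (x * y) (W v)) -
      adjoint W' (diagHom ι₀ x (W (adjoint W' (diagHom ι₀ y (W v))))) =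
      adjoint W' (P (diagHom ι₀ x (diagHom ι₀ y (W v))) -
        diagHom ι₀ x (P (diagHom ι₀ y (W v))))
    rw [hu', hu, map_sub, hadj, map_mul]
    rfl
  rw [key]
  calc _ ≤ ‖(P * diagHom ι₀ x - diagHom ι₀ x * P) (diagHom ι₀ y (W v))‖ :=
        norm_adjoint_isometry_apply_le (V := W') W.norm_map _
    _ ≤ ‖P * diagHom ι₀ x - diagHom ι₀ x * P‖ * ‖diagHom ι₀ y (W v)‖ := le_opNorm _ _
    _ ≤ ‖P * diagHom ι₀ x - diagHom ι₀ x * P‖ * (‖y‖ * ‖v‖) := by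
      gcongr
      rw [← W.norm_map v]
      exact le_of_opNorm_le _ (NonUnitalStarAlgHom.norm_apply_le (diagHom ι₀) y) _
    _ = _ := by ring

lemma norm_gap_of_spectrum_subset.{u} (X : Set A) (hXfin : X.Finite)
    (hXball : ∀ x ∈ X, ‖x‖ ≤ 1) {ε : ℝ} (hε : 0 < ε) (k : ℕ)
    {p : Matrix (Fin 2) (Fin 2) (H →L[ℂ] H)} (hp_idem : p * p = p) (hp_sa : star p = p)
    (hp_comm : ∀ x ∈ X,
      ‖matOp (p * Matrix.diagonal (fun _ : Fin 2 => ι₀ x) -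
          Matrix.diagonal (fun _ : Fin 2 => ι₀ x) * p)‖ < ε)
    {q : Matrix (Fin k) (Fin k) A} (hq_sa : star q = q)
    (hq_spec : ∀ (C : Type u) [CStarAlgebra C], ∀ φ : A →ₗ[ℂ] C, φ 1 = 1 →
      (∀ (j : ℕ) (m : Matrix (Fin j) (Fin j) A), (∃ y : Matrix (Fin j) (Fin j) A, m = star y * y) →
        ∃ z : Matrix (Fin j) (Fin j) C, m.map φ = star z * z) →
      (∀ x ∈ X, ‖φ (star x) - star (φ x)‖ < ε) →
      (∀ x ∈ X, ∀ y ∈ X, ‖φ (x * y) - φ x * φ y‖ < ε) →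
      spectrum ℂ (q.map ⇑φ) ⊆
        Complex.ofReal '' (Set.Ico (0 : ℝ) (1 / 4) ∪ Set.Ioc (3 / 4) 1))
    (t : PiLp 2 fun _ : Fin 2 × Fin k => H) (ht : matOp (bAmp p k) t = t) :
    (1 / 4) * ‖t‖ ≤ ‖matOp (bAmp p k) (matOp (qAmp ι₀ q) t) - (1 / 2 : ℂ) • t‖ := by
  have hp := isStarProjection_matOp hp_idem hp_sa
  have hpp : ∀ x, matOp p (matOp p x) = matOp p x := fun x =>
    congrArg (fun T => T x) hp.isIdempotentElem.eq
  have hP : IsSelfAdjoint (matOp (bAmp p k)) := by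
    rw [IsSelfAdjoint, ← matOp_star, ← bAmp_star, hp_sa]
  let τ : Fin k → PiLp 2 fun _ : Fin 2 => H := fun i => WithLp.toLp 2 fun a => t (a, i)
  obtain ⟨ι, W, hτW, hSW, hpW⟩ := exists_isometry_small.{u} (p := matOp p)
    (S := (fun x => matOp p * diagHom ι₀ x * matOp p) '' X) (hXfin.image _).countable τ
    (fun i => by
      ext a
      rw [← matOp_bAmp_apply, ht])
    (by
      rintro _ ⟨x, -, rfl⟩
      rw [← mul_assoc, ← mul_assoc, hp.isIdempotentElem.eq])
  set W' := W.toContinuousLinearMap with hW'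
  set U := amplIsometry W k with hU
  choose r hr using hτW
  let r₀ : PiLp 2 fun _ : Fin k => lp (fun _ : ι => ℂ) 2 := WithLp.toLp 2 r
  have hUr : U r₀ = t := by
    ext ⟨a, i⟩
    exact congrArg (fun z => z a) (hr i)
  have hPU : ∀ v, matOp (bAmp p k) (U v) = U v := by
    intro v
    ext ⟨a, i⟩
    rw [matOp_bAmp_apply]
    exact congrArg (fun z => z a) (hpW (v i))
  have hmul : ∀ x ∈ X, ∀ y ∈ X,
      ‖compr ι₀ W' (x * y) - compr ι₀ W' x * compr ι₀ W' y‖ < ε := by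
    intro x hx y hy
    refine (norm_compr_mul_sub_le ι₀ hp.isSelfAdjoint hpW x fun v => ?_).trans_lt ?_
    · have := hSW _ ⟨y, hy, rfl⟩ v
      simpa [hpW] using this
    · have h := hp_comm x hx
      rw [matOp_sub, matOp_mul, matOp_mul, ← diagHom_apply] at h
      exact (mul_le_of_le_one_right (norm_nonneg _) (hXball y hy)).trans_lt h
  have hspec := hq_spec _ (compr ι₀ W') (compr_one ι₀ W)
    (by rintro j _ ⟨y, rfl⟩; exact compr_completelyPositive ι₀ W' y)
    (fun x _ => by rw [compr_star, sub_self, norm_zero]; exact hε) hmul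
  have hQ : IsSelfAdjoint (matOp (qAmp ι₀ q)) := by
    rw [IsSelfAdjoint, ← matOp_star, ← qAmp_star, hq_sa]
  have hTspec : spectrum ℂ (matOp (q.map (compr ι₀ W'))) = spectrum ℂ (q.map (compr ι₀ W')) :=
    AlgEquiv.spectrum_eq (matOpEquiv (H := lp (fun _ : ι => ℂ) 2) (ι := Fin k)) _
  have hgap := norm_gap_of_compression hP hQ (U := U) hPU (a := 1 / 2) (c := 1 / 4) (by norm_num)
    (fun s hs => by
      rw [amplIsometry_toContinuousLinearMap, ← matOp_map_compr] at hs
      have h1 := hspec (hTspec ▸ spectrum.algebraMap_mem ℂ hs)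
      obtain ⟨s', hs', h2⟩ := h1
      obtain rfl : s' = s := Complex.ofReal_injective h2
      rcases hs' with h | h
      · rw [abs_of_neg] <;> linarith [h.1, h.2]
      · rw [abs_of_pos] <;> linarith [h.1, h.2]) r₀
  rw [hUr] at hgap
  simpa using hgap

end Gap

/-- Let `A ⊆ B(H)` be a unital C*-subalgebra (realized here by an
isometric unital *-homomorphism `ι₀ : A → B(H)`), `X` a finite self-adjoint subset of the
closed unit ball of `A`, `ε ∈ (0,1/24)` and `k ≥ 1`.  Let `p ∈ M₂(B(H))` be a projection
with `p − e ∈ M₂(K(H))` that `ε`-commutes with `diag(x,x)` for `x ∈ X`, and let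
`q ∈ M_k(A)` be a projection which is `(X,ε)`-compatible (every ucp `(X,ε)`-*-homomorphism
`φ : A → C` sends `q` to a matrix with spectrum in `[0,1/4) ∪ (3/4,1]`).  Then
`s := e⊗1_k + (1₂⊗q)(b⊗1_k)(1₂⊗q)` is self-adjoint, `1/2` is not in its spectrum,
`χ(s)` is a projection, and `χ(s) − e⊗1_k` is in `M₂(M_k(K(H)))`. -/
theorem statement6 {H : Type*} [NormedAddCommGroup H] [InnerProductSpace ℂ H]
    [CompleteSpace H] {A : Type*} [CStarAlgebra A]
    (ι₀ : A →⋆ₐ[ℂ] (H →L[ℂ] H)) (hι₀ : Isometry ι₀)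
    (X : Set A) (hXfin : X.Finite) (hXsa : ∀ x ∈ X, star x ∈ X)
    (hXball : ∀ x ∈ X, ‖x‖ ≤ 1)
    (ε : ℝ) (hε : ε ∈ Set.Ioo (0 : ℝ) (1 / 24))
    (k : ℕ) (hk : 1 ≤ k)
    (p : Matrix (Fin 2) (Fin 2) (H →L[ℂ] H))
    (hp_idem : p * p = p) (hp_sa : star p = p)
    (hb_compact : ∀ i j : Fin 2, IsCompactOperator ⇑((p - eMat H) i j))
    (hp_comm : ∀ x ∈ X,
      ‖matOp (p * Matrix.diagonal (fun _ : Fin 2 => ι₀ x) -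
          Matrix.diagonal (fun _ : Fin 2 => ι₀ x) * p)‖ < ε)
    (q : Matrix (Fin k) (Fin k) A)
    (hq_idem : q * q = q) (hq_sa : star q = q)
    (hq_spec : ∀ (C : Type*) [CStarAlgebra C], ∀ φ : A →ₗ[ℂ] C, φ 1 = 1 →
      (∀ (j : ℕ) (m : Matrix (Fin j) (Fin j) A), (∃ y : Matrix (Fin j) (Fin j) A, m = star y * y) →
        ∃ z : Matrix (Fin j) (Fin j) C, m.map φ = star z * z) →
      (∀ x ∈ X, ‖φ (star x) - star (φ x)‖ < ε) →
      (∀ x ∈ X, ∀ y ∈ X, ‖φ (x * y) - φ x * φ y‖ < ε) →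
      spectrum ℂ (q.map ⇑φ) ⊆
        Complex.ofReal '' (Set.Ico (0 : ℝ) (1 / 4) ∪ Set.Ioc (3 / 4) 1)) :
    IsSelfAdjoint (matOp (eMatAmp H k + qAmp ι₀ q * bAmp (p - eMat H) k * qAmp ι₀ q)) ∧
    (1 / 2 : ℝ) ∉
      spectrum ℝ (matOp (eMatAmp H k + qAmp ι₀ q * bAmp (p - eMat H) k * qAmp ι₀ q)) ∧
    IsSelfAdjoint (cfc (fun r : ℝ => if 1 / 2 < r then (1 : ℝ) else 0)
      (matOp (eMatAmp H k + qAmp ι₀ q * bAmp (p - eMat H) k * qAmp ι₀ q))) ∧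
    IsIdempotentElem (cfc (fun r : ℝ => if 1 / 2 < r then (1 : ℝ) else 0)
      (matOp (eMatAmp H k + qAmp ι₀ q * bAmp (p - eMat H) k * qAmp ι₀ q))) ∧
    IsCompactOperator
      ⇑(cfc (fun r : ℝ => if 1 / 2 < r then (1 : ℝ) else 0)
          (matOp (eMatAmp H k + qAmp ι₀ q * bAmp (p - eMat H) k * qAmp ι₀ q)) -
        matOp (eMatAmp H k)) := by
  have he : IsStarProjection (matOp (eMatAmp H k)) := by
    rw [eMatAmp_eq_bAmp]
    exact isStarProjection_matOp (by rw [← bAmp_mul, eMat_mul_self])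
      (by rw [← bAmp_star, eMat_star])
  have hP : IsStarProjection (matOp (bAmp p k)) :=
    isStarProjection_matOp (by rw [← bAmp_mul, hp_idem]) (by rw [← bAmp_star, hp_sa])
  have hQ : IsStarProjection (matOp (qAmp ι₀ q)) :=
    isStarProjection_matOp (by rw [← qAmp_mul, hq_idem]) (by rw [← qAmp_star, hq_sa])
  have heQ : matOp (eMatAmp H k) * matOp (qAmp ι₀ q) =
      matOp (qAmp ι₀ q) * matOp (eMatAmp H k) := by
    rw [← matOp_mul, ← matOp_mul, eMatAmp_commute_qAmp]
  have hs : matOp (eMatAmp H k + qAmp ι₀ q * bAmp (p - eMat H) k * qAmp ι₀ q) =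
      matOp (eMatAmp H k) + matOp (qAmp ι₀ q) * (matOp (bAmp p k) - matOp (eMatAmp H k)) *
        matOp (qAmp ι₀ q) := by
    rw [matOp_add, matOp_mul, matOp_mul, bAmp_sub, matOp_sub, ← eMatAmp_eq_bAmp]
  have hcompact : IsCompactOperator
      (matOp (eMatAmp H k + qAmp ι₀ q * bAmp (p - eMat H) k * qAmp ι₀ q) -
        matOp (eMatAmp H k)) := by
    rw [matOp_add, add_sub_cancel_left, matOp_mul, matOp_mul]
    have hb : IsCompactOperator (matOp (bAmp (p - eMat H) k)) := by
      refine isCompactOperator_matOp fun x y => ?_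
      simp only [bAmp, Matrix.of_apply]
      split_ifs
      · exact hb_compact _ _
      · exact isCompactOperator_zero
    exact (hb.clm_comp (matOp (qAmp ι₀ q))).comp_clm (matOp (qAmp ι₀ q))
  have hsa : IsSelfAdjoint
      (matOp (eMatAmp H k + qAmp ι₀ q * bAmp (p - eMat H) k * qAmp ι₀ q)) := by
    rw [hs]
    exact isSelfAdjoint_add_conj hP hQ he
  have hspec : (1 / 2 : ℝ) ∉
      spectrum ℝ (matOp (eMatAmp H k + qAmp ι₀ q * bAmp (p - eMat H) k * qAmp ι₀ q)) := by
    refine hsa.notMem_spectrum_of_bounded_below (c := 1 / 16) (by norm_num) fun v => ?_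
    have := bounded_below_of_gap hP hQ he heQ (norm_gap_of_spectrum_subset ι₀ X hXfin hXball
      hε.1 k hp_idem hp_sa hp_comm hq_sa hq_spec) v
    rw [← hs] at this
    simpa using this
  exact ⟨hsa, hspec, cfc_indicator_of_compact_sub hsa he hspec hcompact⟩

end
end

section
/- Let A be a separable unital C*-algebra, X a finite self-adjoint subset of the closed unit ball of A, and ε, δ > 0. Let H be a separable complex Hilbert space and suppose A is a unital C*-subalgebra of B(H) such that A ∩ K(H) = {0}, where K(H) denotes the compact operators. Let φ : A → M_n(ℂ) be a unital completely positive (X,δ)-*-homomorphism. Then there exist an orthogonal projection p ∈ B(H) of rank n and a unitary isomorphism u : ℂⁿ → pH such that ‖u*(p a p)u − φ(a)‖ < ε and ‖pa − ap‖ < 2√(3ε+δ) for all a ∈ X (where u*(pap)u denotes the operator on ℂⁿ obtained by conjugating the compression of a to the range of p by u). -/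
open scoped Matrix.Norms.L2Operator InnerProductSpace

/-- A linear map `φ : A → M_n(ℂ)` is *unital completely positive* if `φ 1 = 1` and, for every
`j`, applying `φ` entrywise to `j × j` matrices sends positive elements of `M_j(A)` (i.e.
elements of the form `star y * y`) to positive elements of `M_j(M_n(ℂ))`. -/
def IsUcpToMat {A : Type*} [CStarAlgebra A] {n : ℕ}
    (φ : A →ₗ[ℂ] Matrix (Fin n) (Fin n) ℂ) : Prop :=
  φ 1 = 1 ∧
    ∀ (j : ℕ) (m : Matrix (Fin j) (Fin j) A),
      (∃ y : Matrix (Fin j) (Fin j) A, m = star y * y) →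
      ∃ z : Matrix (Fin j) (Fin j) (Matrix (Fin n) (Fin n) ℂ), m.map φ = star z * z

section CStar

variable {A : Type*} [CStarAlgebra A]

/-- A self-adjoint element is a difference of squares of orthogonal self-adjoint elements. -/
lemma exists_sq_sub_sq_of_isSelfAdjoint (h : A) (hh : IsSelfAdjoint h) :
    ∃ y z : A, IsSelfAdjoint y ∧ IsSelfAdjoint z ∧ h = z * z - y * y ∧ y * z = 0 := by
  have hy : Continuous fun x : ℝ => √(max (-x) 0) := by fun_prop
  have hz : Continuous fun x : ℝ => √(max x 0) := by fun_prop
  refine ⟨cfc (fun x : ℝ => √(max (-x) 0)) h, cfc (fun x : ℝ => √(max x 0)) h,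
    cfc_predicate _ _, cfc_predicate _ _, ?_, ?_⟩
  · rw [← cfc_mul _ _ h, ← cfc_mul _ _ h, ← cfc_sub _ _ h]
    conv_lhs => rw [← cfc_id' ℝ h]
    congr 1
    funext x
    rw [Real.mul_self_sqrt (le_max_right _ _), Real.mul_self_sqrt (le_max_right _ _)]
    rcases le_total x 0 with hx | hx
    · rw [max_eq_right hx, max_eq_left (by linarith)]; ring
    · rw [max_eq_left hx, max_eq_right (by linarith)]; ring
  · rw [← cfc_mul _ _ h, ← cfc_zero ℝ h]
    congr 1
    funext x
    rcases le_total x 0 with hx | hx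
    · rw [max_eq_right hx]; simp
    · rw [max_eq_right (a := -x) (by linarith)]; simp

/-- The same decomposition for matrices over a C⋆-algebra. -/
lemma Matrix.exists_sq_sub_sq_of_star_eq {n : ℕ} (h : Matrix (Fin n) (Fin n) A)
    (hh : star h = h) :
    ∃ y z : Matrix (Fin n) (Fin n) A,
      star y = y ∧ star z = z ∧ h = z * z - y * y ∧ y * z = 0 := by
  let _ := CStarAlgebra.spectralOrder A
  have := CStarAlgebra.spectralOrderedRing A
  obtain ⟨y, z, hy, hz, h1, h2⟩ :=
    exists_sq_sub_sq_of_isSelfAdjoint (A := CStarMatrix (Fin n) (Fin n) A) h hh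
  exact ⟨y, z, hy, hz, h1, h2⟩

end CStar

section Amplification

variable {A : Type*} [CStarAlgebra A]
  {H : Type*} [NormedAddCommGroup H] [InnerProductSpace ℂ H] [CompleteSpace H]

/-- A matrix over `A` acting on tuples of vectors through a representation of `A`. -/
noncomputable def matAct (ι₀ : A →⋆ₐ[ℂ] (H →L[ℂ] H)) {n : ℕ} (M : Matrix (Fin n) (Fin n) A) :
    (Fin n → H) →ₗ[ℂ] (Fin n → H) :=
  LinearMap.pi fun i => ∑ j, (ι₀ (M i j)).toLinearMap ∘ₗ LinearMap.proj j

variable (ι₀ : A →⋆ₐ[ℂ] (H →L[ℂ] H)) {n : ℕ}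

lemma matAct_apply (M : Matrix (Fin n) (Fin n) A) (ξ : Fin n → H) (i : Fin n) :
    matAct ι₀ M ξ i = ∑ j, ι₀ (M i j) (ξ j) := by
  simp [matAct]

lemma matAct_mul (M N : Matrix (Fin n) (Fin n) A) (ξ : Fin n → H) :
    matAct ι₀ (M * N) ξ = matAct ι₀ M (matAct ι₀ N ξ) := by
  ext i
  simp only [matAct_apply, Matrix.mul_apply, map_sum, map_mul, sum_apply,
    mul_apply_eq_comp]
  rw [Finset.sum_comm]

lemma inner_rep_left (a : A) (x y : H) : ⟪ι₀ a x, y⟫_ℂ = ⟪x, ι₀ (star a) y⟫_ℂ := by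
  rw [map_star, ContinuousLinearMap.star_eq_adjoint, ContinuousLinearMap.adjoint_inner_right]

lemma sum_inner_matAct_left (M : Matrix (Fin n) (Fin n) A) (ξ η : Fin n → H) :
    ∑ i, ⟪matAct ι₀ M ξ i, η i⟫_ℂ = ∑ i, ⟪ξ i, matAct ι₀ (star M) η i⟫_ℂ := by
  simp only [matAct_apply, sum_inner, inner_sum, inner_rep_left, Matrix.star_apply]
  rw [Finset.sum_comm]

/-- A linear map that vanishes on a subspace of finite codimension has finite-dimensional range. -/
lemma finiteDimensional_range_of_ker_le {E F G : Type*} [AddCommGroup E] [Module ℂ E]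
    [AddCommGroup F] [Module ℂ F] [AddCommGroup G] [Module ℂ G] [FiniteDimensional ℂ G]
    (T : E →ₗ[ℂ] F) (L : E →ₗ[ℂ] G) (h : LinearMap.ker L ≤ LinearMap.ker T) :
    FiniteDimensional ℂ (LinearMap.range T) := by
  obtain ⟨g, hg⟩ := LinearMap.exists_extend
    ((LinearMap.ker L).liftQ T h ∘ₗ L.quotKerEquivRange.symm.toLinearMap)
  have hT : T = g ∘ₗ L := by
    ext x
    have := LinearMap.congr_fun hg (L.quotKerEquivRange (Submodule.Quotient.mk x))
    simpa using this.symm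
  rw [hT]
  exact Submodule.finiteDimensional_of_le (LinearMap.range_comp_le_range L g)

omit [CompleteSpace H] in
lemma isCompactOperator_of_finiteDimensional_range (T : H →L[ℂ] H) (S : Submodule ℂ H)
    [FiniteDimensional ℂ S] (h : ∀ x, T x ∈ S) : IsCompactOperator T := by
  have : ProperSpace S := FiniteDimensional.proper ℂ S
  have h1 : IsCompactOperator (T.codRestrict S h) :=
    isCompactOperator_of_locallyCompactSpace_dom (T.codRestrict S h)
  exact h1.clm_comp S.subtypeL

/-- If a representation of `A` contains no nonzero compact operators, then a self-adjoint matrix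
over `A` that is positive on a subspace of finite codimension is positive. -/
lemma exists_eq_star_mul_self_of_nonneg_on_finite_codim
    (h_disjoint : ∀ a : A, IsCompactOperator (⇑(ι₀ a)) → a = 0)
    (h : Matrix (Fin n) (Fin n) A) (hh : star h = h) (s : Finset H)
    (hpos : ∀ ξ : Fin n → H, (∀ i, ∀ v ∈ s, ⟪v, ξ i⟫_ℂ = 0) →
      0 ≤ (∑ i, ⟪ξ i, matAct ι₀ h ξ i⟫_ℂ).re) :
    ∃ y : Matrix (Fin n) (Fin n) A, h = star y * y := by
  obtain ⟨y, z, hy, hz, hdec, hyz⟩ := Matrix.exists_sq_sub_sq_of_star_eq h hh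
  have hcube : y * h * y = -((y * y) * (y * y)) := by
    rw [hdec, mul_sub, ← mul_assoc, hyz]
    noncomm_ring
  let L : (Fin n → H) →ₗ[ℂ] (Fin n → s → ℂ) :=
    LinearMap.pi fun i => LinearMap.pi fun v =>
      (innerSL ℂ (v : H)).toLinearMap ∘ₗ LinearMap.proj i ∘ₗ matAct ι₀ y
  have hL : LinearMap.ker L ≤ LinearMap.ker (matAct ι₀ y) := by
    intro η hη
    have h0 : ∀ i, ∀ v ∈ s, ⟪v, matAct ι₀ y η i⟫_ℂ = 0 := fun i v hv => by
      have := congrFun (congrFun (LinearMap.mem_ker.1 hη) i) ⟨v, hv⟩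
      simpa [L] using this
    have h1 := hpos _ h0
    rw [sum_inner_matAct_left, hy] at h1
    rw [← matAct_mul, ← matAct_mul, hcube] at h1
    have hneg : ∀ (M : Matrix (Fin n) (Fin n) A) (ξ : Fin n → H),
        matAct ι₀ (-M) ξ = - matAct ι₀ M ξ := fun M ξ => by
      ext i; simp [matAct_apply]
    have hyy : star (y * y) = y * y := by rw [star_mul, hy]
    rw [hneg, matAct_mul] at h1
    simp only [Pi.neg_apply, inner_neg_right, Finset.sum_neg_distrib, Complex.neg_re] at h1
    nth_rw 1 [← hyy] at h1
    rw [← sum_inner_matAct_left] at h1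
    have key : ∀ ζ : Fin n → H, (∑ i, ⟪ζ i, ζ i⟫_ℂ).re ≤ 0 → ζ = 0 := by
      intro ζ hζ
      simp only [Complex.re_sum, inner_self_eq_norm_sq_to_K] at hζ
      have hζ' : ∑ i, ‖ζ i‖ ^ 2 ≤ 0 := by
        refine le_trans (le_of_eq (Finset.sum_congr rfl fun i _ => ?_)) hζ
        norm_cast
      ext i
      have := (Finset.sum_eq_zero_iff_of_nonneg (fun i _ => sq_nonneg ‖ζ i‖)).1
        (le_antisymm hζ' (Finset.sum_nonneg fun i _ => sq_nonneg ‖ζ i‖)) i (Finset.mem_univ i)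
      simpa using this
    have h2 : matAct ι₀ (y * y) η = 0 := key _ (by linarith)
    refine LinearMap.mem_ker.2 (key _ ?_)
    rw [sum_inner_matAct_left, hy, ← matAct_mul, h2]
    simp
  have hfin := finiteDimensional_range_of_ker_le (matAct ι₀ y) L hL
  have hy0 : y = 0 := by
    ext i j
    refine h_disjoint _ (isCompactOperator_of_finiteDimensional_range _
      ((LinearMap.range (matAct ι₀ y)).map (LinearMap.proj i)) fun x => ?_)
    refine ⟨matAct ι₀ y (Pi.single j x), ⟨_, rfl⟩, ?_⟩
    rw [LinearMap.proj_apply, matAct_apply, Finset.sum_eq_single j]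
    · simp
    · intro k _ hk; simp [Pi.single_eq_of_ne hk]
    · simp
  refine ⟨z, ?_⟩
  rw [hz, hdec, hy0]
  simp

end Amplification

section Ucp

variable {A : Type*} [CStarAlgebra A] {n : ℕ} {φ : A →ₗ[ℂ] Matrix (Fin n) (Fin n) ℂ}

lemma IsUcpToMat.map_star (hφ : IsUcpToMat φ) (a : A) : φ (star a) = star (φ a) := by
  obtain ⟨z, hz⟩ := hφ.2 2 _ ⟨!![1, a; 0, 0], rfl⟩
  have hs : star ((star !![1, a; 0, 0] * !![1, a; 0, 0] : Matrix (Fin 2) (Fin 2) A).map φ) =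
      (star !![1, a; 0, 0] * !![1, a; 0, 0] : Matrix (Fin 2) (Fin 2) A).map φ := by
    rw [hz, star_mul, star_star]
  have := congrFun (congrFun hs 1) 0
  simpa [Matrix.mul_apply, Matrix.star_apply] using this.symm

/-- The functional on `M_n(A)` associated with a ucp map `A → M_n(ℂ)` is positive. -/
lemma IsUcpToMat.sum_nonneg (hφ : IsUcpToMat φ) (y : Matrix (Fin n) (Fin n) A) :
    0 ≤ (∑ i, ∑ j, φ ((star y * y) i j) i j).re := by
  obtain ⟨z, hz⟩ := hφ.2 n _ ⟨y, rfl⟩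
  have h1 : ∑ i, ∑ j, φ ((star y * y) i j) i j =
      ∑ k, ∑ l, star (∑ i, z k i l i) * ∑ j, z k j l j := by
    have h2 : ∀ i j, φ ((star y * y) i j) i j =
        ∑ k, ∑ l, star (z k i l i) * z k j l j := fun i j => by
      have := congrFun (congrFun (congrFun (congrFun hz i) j) i) j
      rw [Matrix.map_apply] at this
      rw [this]
      simp [Matrix.mul_apply, Matrix.star_apply, Matrix.sum_apply]
    simp only [h2, star_sum, Finset.sum_mul_sum]
    calc _ = ∑ i, ∑ k, ∑ j, ∑ l, star (z k i l i) * z k j l j :=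
          Finset.sum_congr rfl fun i _ => Finset.sum_comm
      _ = ∑ k, ∑ i, ∑ l, ∑ j, star (z k i l i) * z k j l j := by
          rw [Finset.sum_comm]
          exact Finset.sum_congr rfl fun k _ => Finset.sum_congr rfl fun i _ => Finset.sum_comm
      _ = _ := Finset.sum_congr rfl fun k _ => Finset.sum_comm
  rw [h1, Complex.re_sum]
  refine Finset.sum_nonneg fun k _ => ?_
  rw [Complex.re_sum]
  refine Finset.sum_nonneg fun l _ => ?_
  rw [Complex.star_def, ← Complex.normSq_eq_conj_mul_self]
  exact_mod_cast Complex.normSq_nonneg _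

end Ucp

section EssentialRange

variable {A : Type*} [CStarAlgebra A]
  {H : Type*} [NormedAddCommGroup H] [InnerProductSpace ℂ H] [CompleteSpace H]

/-- Tuples of `n` vectors orthogonal to `s` whose squared norms sum to `n`. -/
def IsOrthTuple {n : ℕ} (s : Finset H) (ξ : Fin n → H) : Prop :=
  (∀ i, ∀ v ∈ s, ⟪v, ξ i⟫_ℂ = 0) ∧ ∑ i, ‖ξ i‖ ^ 2 = n

/-- The matrix coefficients of the elements of `F` with respect to a tuple of vectors. -/
noncomputable def matCoeff (ι₀ : A →⋆ₐ[ℂ] (H →L[ℂ] H)) {n : ℕ} (F : Finset A) (ξ : Fin n → H) :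
    F × Fin n × Fin n → ℂ :=
  fun k => ⟪ξ k.2.1, ι₀ k.1 (ξ k.2.2)⟫_ℂ

/-- The joint essential matricial range of the elements of `F`. -/
def essRange (ι₀ : A →⋆ₐ[ℂ] (H →L[ℂ] H)) (n : ℕ) (F : Finset A) :
    Set (F × Fin n × Fin n → ℂ) :=
  ⋂ s : Finset H, closure (matCoeff ι₀ F '' {ξ : Fin n → H | IsOrthTuple s ξ})

variable (ι₀ : A →⋆ₐ[ℂ] (H →L[ℂ] H)) {n : ℕ}

lemma isClosed_essRange (F : Finset A) : IsClosed (essRange ι₀ n F) :=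
  isClosed_iInter fun _ => isClosed_closure

lemma IsOrthTuple.combine {s s' : Finset H} {ξ η : Fin n → H} (hξ : IsOrthTuple s ξ)
    (hη : IsOrthTuple s' η) (hs : s ⊆ s') (F : Finset A) (hξs : ∀ i, ξ i ∈ s')
    (hF : ∀ a ∈ F, ∀ i, ι₀ a (ξ i) ∈ s' ∧ ι₀ (star a) (ξ i) ∈ s')
    {t t' : ℝ} (ht : 0 ≤ t) (ht' : 0 ≤ t') (htt : t + t' = 1) :
    ∃ ζ : Fin n → H, IsOrthTuple s ζ ∧
      matCoeff ι₀ F ζ = t • matCoeff ι₀ F ξ + t' • matCoeff ι₀ F η := by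
  have e1 : ((√t : ℝ) : ℂ) * ((√t : ℝ) : ℂ) = t := by
    rw [← Complex.ofReal_mul, Real.mul_self_sqrt ht]
  have e2 : ((√t' : ℝ) : ℂ) * ((√t' : ℝ) : ℂ) = t' := by
    rw [← Complex.ofReal_mul, Real.mul_self_sqrt ht']
  refine ⟨fun i => ((√t : ℝ) : ℂ) • ξ i + ((√t' : ℝ) : ℂ) • η i, ⟨fun i v hv => ?_, ?_⟩, ?_⟩
  · rw [inner_add_right, inner_smul_right, inner_smul_right, hξ.1 i v hv, hη.1 i v (hs hv)]
    simp
  · have : ∀ i, ‖((√t : ℝ) : ℂ) • ξ i + ((√t' : ℝ) : ℂ) • η i‖ ^ 2 =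
        t * ‖ξ i‖ ^ 2 + t' * ‖η i‖ ^ 2 := fun i => by
      rw [norm_add_sq (𝕜 := ℂ), inner_smul_left, inner_smul_right, hη.1 i _ (hξs i)]
      simp [norm_smul, mul_pow, Real.sq_sqrt ht, Real.sq_sqrt ht']
    simp only [this, Finset.sum_add_distrib, ← Finset.mul_sum, hξ.2, hη.2]
    rw [← add_mul, htt, one_mul]
  · funext ⟨a, i, j⟩
    have h1 : ⟪ξ i, ι₀ a (η j)⟫_ℂ = 0 := by
      have := hη.1 j _ (hF a a.2 i).2
      rwa [inner_rep_left, star_star] at this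
    have h2 : ⟪η i, ι₀ a (ξ j)⟫_ℂ = 0 := by
      rw [← inner_conj_symm, hη.1 i _ (hF a a.2 j).1, map_zero]
    simp only [matCoeff, map_add, map_smul, inner_add_left, inner_add_right, inner_smul_left,
      inner_smul_right, h1, h2, Complex.conj_ofReal, Pi.add_apply, Pi.smul_apply,
      Complex.real_smul, ← e1, ← e2]
    ring

lemma convex_essRange (F : Finset A) : Convex ℝ (essRange ι₀ n F) := by
  classical
  intro w hw w' hw' t t' ht ht' htt
  refine Set.mem_iInter.2 fun s => Metric.mem_closure_iff.2 fun r hr => ?_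
  obtain ⟨_, ⟨ξ, hξ, rfl⟩, h1⟩ := Metric.mem_closure_iff.1 (Set.mem_iInter.1 hw s) r hr
  let s' : Finset H := s ∪ Finset.univ.image ξ ∪
    (F ×ˢ Finset.univ).image (fun p => ι₀ p.1 (ξ p.2)) ∪
    (F ×ˢ Finset.univ).image (fun p => ι₀ (star p.1) (ξ p.2))
  obtain ⟨_, ⟨η, hη, rfl⟩, h2⟩ := Metric.mem_closure_iff.1 (Set.mem_iInter.1 hw' s') r hr
  obtain ⟨ζ, hζ, hcoeff⟩ := IsOrthTuple.combine ι₀ hξ hη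
    (fun v hv => by simp [s', hv]) F (fun i => by simp [s'])
    (fun a ha i => ⟨by
      simp only [s', Finset.mem_union]
      exact Or.inl (Or.inr (Finset.mem_image.2 ⟨(a, i), by simp [ha], rfl⟩)), by
      simp only [s', Finset.mem_union]
      exact Or.inr (Finset.mem_image.2 ⟨(a, i), by simp [ha], rfl⟩)⟩) ht ht' htt
  refine ⟨_, ⟨ζ, hζ, rfl⟩, ?_⟩
  rw [dist_eq_norm] at h1 h2 ⊢
  have := convex_ball (0 : F × Fin n × Fin n → ℂ) r (mem_ball_zero_iff.2 h1)
    (mem_ball_zero_iff.2 h2) ht ht' htt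
  rw [mem_ball_zero_iff] at this
  have heq : t • w + t' • w' - (t • matCoeff ι₀ F ξ + t' • matCoeff ι₀ F η) =
      t • (w - matCoeff ι₀ F ξ) + t' • (w' - matCoeff ι₀ F η) := by module
  rw [hcoeff, heq]
  exact this

lemma IsOrthTuple.norm_matCoeff_le {s : Finset H} {ξ : Fin n → H} (hξ : IsOrthTuple s ξ)
    (F : Finset A) : ‖matCoeff ι₀ F ξ‖ ≤ n * ∑ a ∈ F, ‖ι₀ a‖ := by
  rw [pi_norm_le_iff_of_nonneg (by positivity)]
  rintro ⟨a, i, j⟩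
  have hle : ∀ i, ‖ξ i‖ ^ 2 ≤ n := fun i => by
    rw [← hξ.2]
    exact Finset.single_le_sum (f := fun i => ‖ξ i‖ ^ 2) (fun i _ => sq_nonneg _)
      (Finset.mem_univ i)
  calc ‖⟪ξ i, ι₀ a (ξ j)⟫_ℂ‖ ≤ ‖ξ i‖ * (‖ι₀ a‖ * ‖ξ j‖) :=
        (norm_inner_le_norm _ _).trans (by gcongr; exact (ι₀ a).le_opNorm _)
    _ = (‖ξ i‖ * ‖ξ j‖) * ‖ι₀ a‖ := by ring
    _ ≤ n * ∑ a ∈ F, ‖ι₀ a‖ := by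
      gcongr
      · nlinarith [hle i, hle j, sq_nonneg (‖ξ i‖ - ‖ξ j‖)]
      · exact Finset.single_le_sum (f := fun a => ‖ι₀ a‖) (fun _ _ => norm_nonneg _) a.2

/-- A half space containing the essential range strictly inside contains the coefficients of all
tuples orthogonal to some finite set. -/
lemma exists_finset_le_of_lt_essRange (F : Finset A)
    (f : StrongDual ℂ (F × Fin n × Fin n → ℂ)) (u : ℝ)
    (hf : ∀ w ∈ essRange ι₀ n F, u < (f w).re) :
    ∃ s : Finset H, ∀ ξ : Fin n → H, IsOrthTuple s ξ → u ≤ (f (matCoeff ι₀ F ξ)).re := by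
  by_contra! hcon
  choose ξ hξ hlt using hcon
  obtain ⟨w, -, hw⟩ := (isCompact_closedBall (0 : F × Fin n × Fin n → ℂ)
    (n * ∑ a ∈ F, ‖ι₀ a‖)).exists_mapClusterPt (f := Filter.atTop)
    (u := fun s => matCoeff ι₀ F (ξ s)) (by
      rw [Filter.le_principal_iff]
      exact Filter.mem_map.2 (Filter.Eventually.of_forall fun s =>
        mem_closedBall_zero_iff.2 ((hξ s).norm_matCoeff_le ι₀ F)))
  have hmem : w ∈ essRange ι₀ n F := by
    refine Set.mem_iInter.2 fun s => mem_closure_iff_nhds.2 fun U hU => ?_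
    obtain ⟨s', hs', hU'⟩ := Filter.frequently_atTop.1 (hw.frequently hU) s
    exact ⟨_, hU', ⟨ξ s', ⟨fun i v hv => (hξ s').1 i v (hs' hv), (hξ s').2⟩, rfl⟩⟩
  have hnhds : {v | u < (f v).re} ∈ nhds w :=
    (isOpen_lt continuous_const (Complex.continuous_re.comp f.continuous)).mem_nhds (hf w hmem)
  obtain ⟨s, hs⟩ := (hw.frequently hnhds).exists
  exact absurd hs (not_lt.2 (hlt s).le)

lemma linear_functional_matCoeff (F : Finset A) (f : StrongDual ℂ (F × Fin n × Fin n → ℂ)) :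
    ∃ b : Matrix (Fin n) (Fin n) A,
      (∀ ξ : Fin n → H, f (matCoeff ι₀ F ξ) = ∑ i, ⟪ξ i, matAct ι₀ b ξ i⟫_ℂ) ∧
      ∀ φ : A →ₗ[ℂ] Matrix (Fin n) (Fin n) ℂ,
        f (fun k => φ k.1 k.2.1 k.2.2) = ∑ i, ∑ j, φ (b i j) i j := by
  classical
  have hexp : ∀ w : F × Fin n × Fin n → ℂ,
      f w = ∑ i, ∑ j, ∑ a : F, w (a, i, j) * f (Pi.single (a, i, j) 1) := fun w => by
    have := LinearMap.pi_apply_eq_sum_univ f.toLinearMap w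
    simp only [ContinuousLinearMap.coe_coe] at this
    rw [this, Fintype.sum_prod_type, Finset.sum_comm, Fintype.sum_prod_type]
    refine Finset.sum_congr rfl fun i _ => Finset.sum_congr rfl fun j _ =>
      Finset.sum_congr rfl fun a _ => ?_
    rw [smul_eq_mul]
    congr 2
    funext k
    simp only [Pi.single_apply, eq_comm]
  refine ⟨Matrix.of fun i j => ∑ a : F, f (Pi.single (a, i, j) 1) • (a : A), fun ξ => ?_, fun φ => ?_⟩
  · rw [hexp]
    simp only [Matrix.of_apply, matAct_apply, inner_sum, map_sum, map_smul, sum_apply,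
      smul_apply, inner_smul_right, matCoeff]
    simp only [mul_comm]
  · rw [hexp]
    simp only [Matrix.of_apply, map_sum, map_smul, Matrix.sum_apply, Matrix.smul_apply, smul_eq_mul, mul_comm]

lemma matAct_add (M N : Matrix (Fin n) (Fin n) A) (ξ : Fin n → H) :
    matAct ι₀ (M + N) ξ = matAct ι₀ M ξ + matAct ι₀ N ξ := by
  ext i
  simp [matAct_apply, Finset.sum_add_distrib]

lemma matAct_smul_one (c : ℂ) (ξ : Fin n → H) :
    matAct ι₀ (c • (1 : Matrix (Fin n) (Fin n) A)) ξ = c • ξ := by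
  ext i
  rw [matAct_apply, Finset.sum_eq_single i]
  · simp
  · intro j _ hj; simp [Matrix.one_apply_ne hj.symm]
  · simp

omit [CompleteSpace H] in
lemma IsOrthTuple.smul_of_orth {s : Finset H} {ξ : Fin n → H}
    (hξ : ∀ i, ∀ v ∈ s, ⟪v, ξ i⟫_ℂ = 0) {N : ℝ} (hN : ∑ i, ‖ξ i‖ ^ 2 = N) (hN0 : 0 < N) :
    IsOrthTuple s (fun i => ((√(n / N) : ℝ) : ℂ) • ξ i) := by
  refine ⟨fun i v hv => by rw [inner_smul_right, hξ i v hv, mul_zero], ?_⟩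
  have : ∀ i, ‖((√(n / N) : ℝ) : ℂ) • ξ i‖ ^ 2 = n / N * ‖ξ i‖ ^ 2 := fun i => by
    rw [norm_smul, mul_pow, Complex.norm_real, Real.norm_eq_abs, sq_abs,
      Real.sq_sqrt (by positivity)]
  simp only [this, ← Finset.mul_sum, hN]
  field_simp

/-- The values of a ucp map lie in the essential matricial range. -/
lemma IsUcpToMat.mem_essRange
    (h_disjoint : ∀ a : A, IsCompactOperator (⇑(ι₀ a)) → a = 0) (hn : n ≠ 0)
    {φ : A →ₗ[ℂ] Matrix (Fin n) (Fin n) ℂ} (hφ : IsUcpToMat φ) (F : Finset A) :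
    (fun k : F × Fin n × Fin n => φ k.1 k.2.1 k.2.2) ∈ essRange ι₀ n F := by
  by_contra hnot
  obtain ⟨f, u, hfu, hf⟩ := RCLike.geometric_hahn_banach_point_closed (𝕜 := ℂ)
    (convex_essRange ι₀ F) (isClosed_essRange ι₀ F) hnot
  simp only [RCLike.re_eq_complex_re] at hfu hf
  obtain ⟨s, hs⟩ := exists_finset_le_of_lt_essRange ι₀ F f u hf
  obtain ⟨b, hb, hbφ⟩ := linear_functional_matCoeff ι₀ F f
  have hn' : (n : ℝ) ≠ 0 := by exact_mod_cast hn
  have hn0 : (0 : ℝ) < n := by positivity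
  let c : ℝ := 2 * u / n
  let h : Matrix (Fin n) (Fin n) A := b + star b + (-(c : ℂ)) • (1 : Matrix (Fin n) (Fin n) A)
  have hh : star h = h := by
    simp only [h, star_add, star_star, star_smul, star_neg, star_one, Complex.star_def,
      Complex.conj_ofReal]
    rw [add_comm (star b)]
  obtain ⟨y, hy⟩ := exists_eq_star_mul_self_of_nonneg_on_finite_codim ι₀ h_disjoint h hh s (by
    intro ξ hξ
    have hsq : (∑ i, ⟪ξ i, ξ i⟫_ℂ).re = ∑ i, ‖ξ i‖ ^ 2 := by
      rw [Complex.re_sum]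
      refine Finset.sum_congr rfl fun i _ => ?_
      rw [inner_self_eq_norm_sq_to_K]
      norm_cast
    have hstar : (∑ i, ⟪ξ i, matAct ι₀ (star b) ξ i⟫_ℂ).re =
        (∑ i, ⟪ξ i, matAct ι₀ b ξ i⟫_ℂ).re := by
      rw [← sum_inner_matAct_left, Complex.re_sum, Complex.re_sum]
      refine Finset.sum_congr rfl fun i _ => ?_
      rw [← inner_conj_symm, Complex.conj_re]
    have hexp : (∑ i, ⟪ξ i, matAct ι₀ h ξ i⟫_ℂ).re =
        2 * (∑ i, ⟪ξ i, matAct ι₀ b ξ i⟫_ℂ).re - c * ∑ i, ‖ξ i‖ ^ 2 := by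
      simp only [h, matAct_add, matAct_smul_one, Pi.add_apply, Pi.smul_apply, inner_add_right,
        inner_smul_right, Finset.sum_add_distrib, Complex.add_re, hstar, ← Finset.mul_sum]
      rw [← Complex.ofReal_neg, Complex.re_ofReal_mul, hsq]
      ring
    rw [hexp]
    rcases (Finset.sum_nonneg fun i _ => sq_nonneg ‖ξ i‖ :
      0 ≤ ∑ i, ‖ξ i‖ ^ 2).eq_or_lt with h0 | hpos
    · have hz : ξ = 0 := by
        ext i
        have := (Finset.sum_eq_zero_iff_of_nonneg (fun i _ => sq_nonneg ‖ξ i‖)).1 h0.symm i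
          (Finset.mem_univ i)
        simpa using this
      simp [hz]
    · have hle := hs _ (IsOrthTuple.smul_of_orth hξ rfl hpos)
      set N := ∑ i, ‖ξ i‖ ^ 2
      rw [hb] at hle
      have hscale : (∑ i, ⟪((√(n / N) : ℝ) : ℂ) • ξ i,
          matAct ι₀ b (fun i => ((√(n / N) : ℝ) : ℂ) • ξ i) i⟫_ℂ).re =
          n / N * (∑ i, ⟪ξ i, matAct ι₀ b ξ i⟫_ℂ).re := by
        have h1 : matAct ι₀ b (fun i => ((√(n / N) : ℝ) : ℂ) • ξ i) =
            ((√(n / N) : ℝ) : ℂ) • matAct ι₀ b ξ := map_smul (matAct ι₀ b) _ ξ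
        rw [h1]
        simp only [Pi.smul_apply, inner_smul_left, inner_smul_right, ← Finset.mul_sum,
          Complex.conj_ofReal]
        rw [Complex.re_ofReal_mul, Complex.re_ofReal_mul, ← mul_assoc,
          Real.mul_self_sqrt (by positivity)]
      rw [hscale] at hle
      have h2 := mul_le_mul_of_nonneg_left hle (by positivity : (0 : ℝ) ≤ 2 * N / n)
      have h3 : 2 * N / n * (n / N * (∑ i, ⟪ξ i, matAct ι₀ b ξ i⟫_ℂ).re) =
          2 * (∑ i, ⟪ξ i, matAct ι₀ b ξ i⟫_ℂ).re := by field_simp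
      have h4 : 2 * N / n * u = c * N := by simp only [c]; ring
      linarith)
  have hpos := hφ.sum_nonneg y
  rw [← hy] at hpos
  have hval : (∑ i, ∑ j, φ (h i j) i j).re = 2 * (∑ i, ∑ j, φ (b i j) i j).re - 2 * u := by
    have hone : ∑ i, ∑ j, φ ((1 : Matrix (Fin n) (Fin n) A) i j) i j = n := by
      have : ∀ i j : Fin n, φ ((1 : Matrix (Fin n) (Fin n) A) i j) i j =
          if i = j then 1 else 0 := fun i j => by
        by_cases hij : i = j
        · subst hij; simp [hφ.1]
        · simp [Matrix.one_apply_ne hij, hij]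
      simp [this]
    have hst : (∑ i, ∑ j, φ ((star b) i j) i j).re = (∑ i, ∑ j, φ (b i j) i j).re := by
      rw [Finset.sum_comm]
      simp only [Matrix.star_apply, hφ.map_star, Complex.re_sum, Complex.star_def,
        Complex.conj_re]
    simp only [h, Matrix.add_apply, Matrix.smul_apply, map_add, map_smul,
      Finset.sum_add_distrib, Complex.add_re, hst]
    simp only [smul_eq_mul, ← Finset.mul_sum, hone]
    rw [← Complex.ofReal_neg, Complex.re_ofReal_mul, Complex.natCast_re]
    simp only [c]
    field_simp
    ring
  rw [hbφ] at hfu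
  linarith

lemma IsUcpToMat.exists_tuple
    (h_disjoint : ∀ a : A, IsCompactOperator (⇑(ι₀ a)) → a = 0)
    {φ : A →ₗ[ℂ] Matrix (Fin n) (Fin n) ℂ} (hφ : IsUcpToMat φ) (F : Finset A)
    {r : ℝ} (hr : 0 < r) :
    ∃ ξ : Fin n → H, ∀ a ∈ F, ∀ i j, ‖⟪ξ i, ι₀ a (ξ j)⟫_ℂ - φ a i j‖ < r := by
  rcases eq_or_ne n 0 with rfl | hn
  · exact ⟨0, fun _ _ i => i.elim0⟩
  obtain ⟨_, ⟨ξ, -, rfl⟩, h⟩ := Metric.mem_closure_iff.1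
    (Set.mem_iInter.1 (hφ.mem_essRange ι₀ h_disjoint hn F) ∅) r hr
  refine ⟨ξ, fun a ha i j => ?_⟩
  rw [dist_comm, dist_eq_norm] at h
  exact (norm_le_pi_norm _ ((⟨a, ha⟩, i, j) : F × Fin n × Fin n)).trans_lt h

end EssentialRange

section Isometry

variable {A : Type*} [CStarAlgebra A]
  {H : Type*} [NormedAddCommGroup H] [InnerProductSpace ℂ H] [CompleteSpace H] {n : ℕ}

lemma toEuclideanCLM_of_inner
    (B : EuclideanSpace ℂ (Fin n) →L[ℂ] EuclideanSpace ℂ (Fin n)) :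
    Matrix.toEuclideanCLM (n := Fin n) (𝕜 := ℂ) (Matrix.of fun i j : Fin n =>
      ⟪EuclideanSpace.single i (1 : ℂ), B (EuclideanSpace.single j 1)⟫_ℂ) = B := by
  refine ContinuousLinearMap.coe_injective ((EuclideanSpace.basisFun (Fin n) ℂ).toBasis.ext
    fun j => ?_)
  ext i
  simp [Matrix.ofLp_toEuclideanCLM, EuclideanSpace.inner_single_left]

lemma Matrix.l2_opNorm_le_of_entry_le (M : Matrix (Fin n) (Fin n) ℂ) {r : ℝ}
    (h : ∀ i j, ‖M i j‖ ≤ r) :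
    ‖M‖ ≤ r * ∑ i, ∑ j, ‖(Matrix.single i j 1 : Matrix (Fin n) (Fin n) ℂ)‖ := by
  conv_lhs => rw [Matrix.matrix_eq_sum_single M]
  rw [Finset.mul_sum]
  refine (norm_sum_le _ _).trans (Finset.sum_le_sum fun i _ => ?_)
  rw [Finset.mul_sum]
  refine (norm_sum_le _ _).trans (Finset.sum_le_sum fun j _ => ?_)
  have : Matrix.single i j (M i j) = M i j • (Matrix.single i j 1 : Matrix (Fin n) (Fin n) ℂ) := by
    rw [Matrix.smul_single, smul_eq_mul, mul_one]
  rw [this, norm_smul]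
  gcongr
  exact h i j

/-- The compression of an operator along a map from `ℂⁿ`. -/
noncomputable def compress (V : EuclideanSpace ℂ (Fin n) →L[ℂ] H) (T : H →L[ℂ] H) :
    EuclideanSpace ℂ (Fin n) →L[ℂ] EuclideanSpace ℂ (Fin n) :=
  ContinuousLinearMap.adjoint V ∘L T ∘L V

lemma inner_compress (V : EuclideanSpace ℂ (Fin n) →L[ℂ] H) (T : H →L[ℂ] H)
    (x y : EuclideanSpace ℂ (Fin n)) : ⟪x, compress V T y⟫_ℂ = ⟪V x, T (V y)⟫_ℂ := by
  simp [compress, ContinuousLinearMap.adjoint_inner_right]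

variable (ι₀ : A →⋆ₐ[ℂ] (H →L[ℂ] H))

lemma IsUcpToMat.exists_compress_near
    (h_disjoint : ∀ a : A, IsCompactOperator (⇑(ι₀ a)) → a = 0)
    {φ : A →ₗ[ℂ] Matrix (Fin n) (Fin n) ℂ} (hφ : IsUcpToMat φ) (F : Finset A)
    {r : ℝ} (hr : 0 < r) :
    ∃ V : EuclideanSpace ℂ (Fin n) →L[ℂ] H, ∀ a ∈ F,
      ‖compress V (ι₀ a) - Matrix.toEuclideanCLM (n := Fin n) (𝕜 := ℂ) (φ a)‖ < r := by
  set C := ∑ i : Fin n, ∑ j : Fin n, ‖(Matrix.single i j 1 : Matrix (Fin n) (Fin n) ℂ)‖ with hC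
  have hC0 : 0 ≤ C := by positivity
  obtain ⟨ξ, hξ⟩ := hφ.exists_tuple ι₀ h_disjoint F (r := r / (C + 1)) (by positivity)
  let V : EuclideanSpace ℂ (Fin n) →L[ℂ] H := LinearMap.toContinuousLinearMap
    ((EuclideanSpace.basisFun (Fin n) ℂ).toBasis.constr ℂ ξ)
  have hV : ∀ i, V (EuclideanSpace.single i 1) = ξ i := fun i => by
    simpa only [OrthonormalBasis.coe_toBasis, EuclideanSpace.basisFun_apply] using!
      (EuclideanSpace.basisFun (Fin n) ℂ).toBasis.constr_basis ℂ ξ i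
  refine ⟨V, fun a ha => ?_⟩
  rw [← toEuclideanCLM_of_inner (compress V (ι₀ a)), ← map_sub, ← Matrix.cstar_norm_def]
  refine (Matrix.l2_opNorm_le_of_entry_le _ (r := r / (C + 1)) fun i j => ?_).trans_lt ?_
  · rw [Matrix.sub_apply, Matrix.of_apply, inner_compress, hV, hV]
    exact (hξ a ha i j).le
  · rw [← hC, div_mul_eq_mul_div, div_lt_iff₀ (by positivity)]
    nlinarith

/-- Polar decomposition of a map whose Gram operator is close to the identity. -/
lemma exists_isometry_mul_of_gram_near (V : EuclideanSpace ℂ (Fin n) →L[ℂ] H)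
    (hV : ‖compress V 1 - 1‖ < 1) :
    ∃ (U : EuclideanSpace ℂ (Fin n) →L[ℂ] H)
      (T : EuclideanSpace ℂ (Fin n) →L[ℂ] EuclideanSpace ℂ (Fin n)),
      compress U 1 = 1 ∧ star T = T ∧ V = U ∘L T ∧ ‖T - 1‖ ≤ ‖compress V 1 - 1‖ := by
  set G := compress V 1 with hG
  have hGsa : IsSelfAdjoint G := by
    rw [IsSelfAdjoint, ContinuousLinearMap.star_eq_adjoint, hG, compress]
    ext1 x
    refine ext_inner_left ℂ fun y => ?_
    simp [ContinuousLinearMap.adjoint_inner_right]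
  have hG1 : G - 1 = cfc (fun x : ℝ => x - 1) G := by
    rw [cfc_sub _ _ G, cfc_id' ℝ G, cfc_const_one ℝ G]
  have hspec : ∀ x ∈ spectrum ℝ G, |x - 1| ≤ ‖G - 1‖ := fun x hx => by
    rw [hG1]
    exact norm_apply_le_norm_cfc (fun x : ℝ => x - 1) G hx
  have hnonneg : ∀ x ∈ spectrum ℝ G, 0 ≤ x := fun x hx => by
    have := (abs_le.1 (hspec x hx)).1
    linarith
  let T := cfc Real.sqrt G
  have hTsa : star T = T := (cfc_predicate Real.sqrt G : IsSelfAdjoint T)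
  have hTT : T * T = G := by
    rw [← cfc_mul _ _ G]
    conv_rhs => rw [← cfc_id' ℝ G]
    exact cfc_congr fun x hx => Real.mul_self_sqrt (hnonneg x hx)
  have hT1 : ‖T - 1‖ ≤ ‖G - 1‖ := by
    have : T - 1 = cfc (fun x : ℝ => √x - 1) G := by
      rw [cfc_sub _ _ G, cfc_const_one ℝ G]
    rw [this]
    refine norm_cfc_le (norm_nonneg _) fun x hx => le_trans ?_ (hspec x hx)
    have h0 := Real.sqrt_nonneg x
    have h1 := Real.sq_sqrt (hnonneg x hx)
    have h2 : x - 1 = (√x - 1) * (√x + 1) := by ring_nf; rw [h1]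
    rw [h2, abs_mul, Real.norm_eq_abs]
    refine le_mul_of_one_le_right (abs_nonneg _) ?_
    rw [abs_of_nonneg (by linarith)]
    linarith
  have hunit : IsUnit T := by
    have := isUnit_one_sub_of_norm_lt_one (x := 1 - T)
      (by rw [norm_sub_rev]; exact hT1.trans_lt hV)
    simpa using this
  obtain ⟨W, hW⟩ := hunit
  have hWT : (↑W⁻¹ : EuclideanSpace ℂ (Fin n) →L[ℂ] EuclideanSpace ℂ (Fin n)) * T = 1 := by
    rw [← hW, Units.inv_mul]
  have hTW : T * (↑W⁻¹ : EuclideanSpace ℂ (Fin n) →L[ℂ] EuclideanSpace ℂ (Fin n)) = 1 := by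
    rw [← hW, Units.mul_inv]
  have hWs : star (↑W⁻¹ : EuclideanSpace ℂ (Fin n) →L[ℂ] EuclideanSpace ℂ (Fin n)) * T = 1 := by
    have := congrArg star hTW
    rwa [star_mul, hTsa, star_one] at this
  refine ⟨V ∘L (↑W⁻¹ : EuclideanSpace ℂ (Fin n) →L[ℂ] EuclideanSpace ℂ (Fin n)), T, ?_, hTsa,
    ?_, hT1⟩
  · have : compress (V ∘L (↑W⁻¹ : EuclideanSpace ℂ (Fin n) →L[ℂ] EuclideanSpace ℂ (Fin n))) 1 =
        star (↑W⁻¹ : EuclideanSpace ℂ (Fin n) →L[ℂ] EuclideanSpace ℂ (Fin n)) * G * ↑W⁻¹ := by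
      rw [hG, compress, ContinuousLinearMap.adjoint_comp]
      rfl
    rw [this, ← hTT, ← mul_assoc, hWs, one_mul, hTW]
  · change V = V ∘L ((↑W⁻¹ : EuclideanSpace ℂ (Fin n) →L[ℂ] EuclideanSpace ℂ (Fin n)) * T)
    rw [hWT]
    rfl

lemma norm_apply_of_compress_one_eq_one (U : EuclideanSpace ℂ (Fin n) →L[ℂ] H)
    (hU : compress U 1 = 1) (x : EuclideanSpace ℂ (Fin n)) : ‖U x‖ = ‖x‖ := by
  have h := inner_compress U 1 x x
  rw [hU, one_apply_eq_self, one_apply_eq_self, inner_self_eq_norm_sq_to_K,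
    inner_self_eq_norm_sq_to_K] at h
  have h' : ‖x‖ ^ 2 = ‖U x‖ ^ 2 := by exact_mod_cast h
  exact ((sq_eq_sq₀ (norm_nonneg _) (norm_nonneg _)).1 h').symm

lemma norm_compress_le (U : EuclideanSpace ℂ (Fin n) →ₗᵢ[ℂ] H) (T : H →L[ℂ] H) :
    ‖compress U.toContinuousLinearMap T‖ ≤ ‖T‖ := by
  have hU : ‖U.toContinuousLinearMap‖ ≤ 1 := U.norm_toContinuousLinearMap_le
  calc ‖compress U.toContinuousLinearMap T‖
      ≤ ‖ContinuousLinearMap.adjoint U.toContinuousLinearMap‖ *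
        (‖T‖ * ‖U.toContinuousLinearMap‖) :=
        (ContinuousLinearMap.opNorm_comp_le _ _).trans
          (by gcongr; exact ContinuousLinearMap.opNorm_comp_le _ _)
    _ ≤ 1 * (‖T‖ * 1) := by
        rw [LinearIsometryEquiv.norm_map]
        gcongr
    _ = ‖T‖ := by ring

lemma norm_sub_conj_le {𝓡 : Type*} [NormedRing 𝓡] (B T : 𝓡) {R q : ℝ} (hB : ‖B‖ ≤ R)
    (hT : ‖T‖ ≤ 2) (hT1 : ‖1 - T‖ ≤ q) : ‖B - T * B * T‖ ≤ 3 * R * q := by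
  have h1 : B - T * B * T = (1 - T) * B + T * B * (1 - T) := by
    rw [sub_mul, mul_sub, one_mul, mul_one]
    abel
  have hR : 0 ≤ R := (norm_nonneg B).trans hB
  have hq : 0 ≤ q := (norm_nonneg _).trans hT1
  rw [h1]
  calc _ ≤ ‖1 - T‖ * ‖B‖ + ‖T‖ * ‖B‖ * ‖1 - T‖ :=
        (norm_add_le _ _).trans (add_le_add (norm_mul_le _ _)
          ((norm_mul_le _ _).trans (by gcongr; exact norm_mul_le _ _)))
    _ ≤ q * R + 2 * R * q := by gcongr
    _ = 3 * R * q := by ring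

/-- Finite-dimensional Voiculescu lemma: ucp maps into matrices are approximated by compressions
along isometries. -/
lemma IsUcpToMat.exists_isometry_compress_near
    (h_disjoint : ∀ a : A, IsCompactOperator (⇑(ι₀ a)) → a = 0)
    {φ : A →ₗ[ℂ] Matrix (Fin n) (Fin n) ℂ} (hφ : IsUcpToMat φ) (F : Finset A)
    {r : ℝ} (hr : 0 < r) :
    ∃ U : EuclideanSpace ℂ (Fin n) →ₗᵢ[ℂ] H, ∀ a ∈ F,
      ‖compress U.toContinuousLinearMap (ι₀ a) -
        Matrix.toEuclideanCLM (n := Fin n) (𝕜 := ℂ) (φ a)‖ < r := by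
  classical
  set R := ∑ a ∈ F, ‖ι₀ a‖ with hR
  have hR0 : 0 ≤ R := by positivity
  set q := min (1 / 2) (r / (3 * R + 1)) with hq
  have hq0 : 0 < q := by positivity
  obtain ⟨V, hV⟩ := hφ.exists_compress_near ι₀ h_disjoint (insert 1 F) hq0
  have hone := hV 1 (Finset.mem_insert_self _ _)
  rw [hφ.1, map_one, map_one] at hone
  have hq1 : q ≤ 1 / 2 := min_le_left _ _
  obtain ⟨U, T, hU, hTs, hVU, hT⟩ := exists_isometry_mul_of_gram_near V (by linarith)
  let u : EuclideanSpace ℂ (Fin n) →ₗᵢ[ℂ] H := ⟨U.toLinearMap, norm_apply_of_compress_one_eq_one U hU⟩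
  have hu : u.toContinuousLinearMap = U := rfl
  refine ⟨u, fun a ha => ?_⟩
  have hB := norm_compress_le u (ι₀ a)
  have hBa : ‖ι₀ a‖ ≤ R := Finset.single_le_sum (f := fun a => ‖ι₀ a‖) (fun _ _ => norm_nonneg _) ha
  have hVa : compress V (ι₀ a) = T * compress U (ι₀ a) * T := by
    rw [compress, hVU, ContinuousLinearMap.adjoint_comp, ← ContinuousLinearMap.star_eq_adjoint T,
      hTs]
    rfl
  rw [hu] at hB ⊢
  set B := compress U (ι₀ a)
  have hTn : ‖T‖ ≤ 2 := by
    have h1 : ‖(1 : EuclideanSpace ℂ (Fin n) →L[ℂ] EuclideanSpace ℂ (Fin n))‖ ≤ 1 :=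
      ContinuousLinearMap.norm_id_le
    have h2 : T = (T - 1) + 1 := by abel
    rw [h2]
    exact (norm_add_le _ _).trans (by linarith)
  have hT1 : ‖1 - T‖ ≤ q := by rw [norm_sub_rev]; linarith
  have hdiff : ‖B - compress V (ι₀ a)‖ ≤ 3 * R * q := by
    rw [hVa]
    exact norm_sub_conj_le B T (hB.trans hBa) hTn hT1
  have hfin : (3 * R + 1) * q ≤ r := by
    have := min_le_right (1 / 2) (r / (3 * R + 1))
    rw [← hq, le_div_iff₀ (by positivity)] at this
    linarith
  have hVr := hV a (Finset.mem_insert_of_mem ha)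
  exact (norm_sub_le_norm_sub_add_norm_sub B (compress V (ι₀ a)) _).trans_lt (by linarith)

lemma norm_sub_mul_lt {𝓡 : Type*} [NormedRing 𝓡] {x b b' y c c' : 𝓡} {r δ : ℝ}
    (hxy : ‖x - y‖ < r) (hb : ‖b - c‖ < r) (hb' : ‖b' - c'‖ < r) (hb1 : ‖b‖ ≤ 1)
    (hb1' : ‖b'‖ ≤ 1) (h : ‖y - c' * c‖ < δ) : ‖x - b' * b‖ < r * (3 + r) + δ := by
  have h1 : x - b' * b = (x - y) + (y - c' * c) - (b' - c') * c - b' * (b - c) := by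
    noncomm_ring
  have hr : 0 < r := (norm_nonneg _).trans_lt hxy
  have hc : ‖c‖ ≤ 1 + r := by
    rw [show c = b - (b - c) by abel]
    exact (norm_sub_le _ _).trans (by linarith)
  have h2 : ‖(b' - c') * c‖ ≤ r * (1 + r) := (norm_mul_le _ _).trans (by gcongr)
  have h3 : ‖b' * (b - c)‖ ≤ 1 * r := (norm_mul_le _ _).trans (by gcongr)
  rw [h1]
  have h4 := norm_sub_le ((x - y) + (y - c' * c) - (b' - c') * c) (b' * (b - c))
  have h5 := norm_sub_le ((x - y) + (y - c' * c)) ((b' - c') * c)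
  have h6 := norm_add_le (x - y) (y - c' * c)
  linarith

/-- The orthogonal projection onto the range of an isometry. -/
noncomputable def rangeProj (U : EuclideanSpace ℂ (Fin n) →ₗᵢ[ℂ] H) : H →L[ℂ] H :=
  U.toContinuousLinearMap ∘L ContinuousLinearMap.adjoint U.toContinuousLinearMap

lemma adjoint_apply_self (U : EuclideanSpace ℂ (Fin n) →ₗᵢ[ℂ] H) (x : EuclideanSpace ℂ (Fin n)) :
    ContinuousLinearMap.adjoint U.toContinuousLinearMap (U x) = x := by
  refine ext_inner_left ℂ fun y => ?_
  rw [ContinuousLinearMap.adjoint_inner_right]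
  exact U.inner_map_map y x

lemma rangeProj_apply_self (U : EuclideanSpace ℂ (Fin n) →ₗᵢ[ℂ] H)
    (x : EuclideanSpace ℂ (Fin n)) : rangeProj U (U x) = U x := by
  change U (ContinuousLinearMap.adjoint U.toContinuousLinearMap (U x)) = U x
  rw [adjoint_apply_self]

lemma rangeProj_mul_self (U : EuclideanSpace ℂ (Fin n) →ₗᵢ[ℂ] H) :
    rangeProj U * rangeProj U = rangeProj U := by
  ext x
  exact rangeProj_apply_self U _

lemma star_rangeProj (U : EuclideanSpace ℂ (Fin n) →ₗᵢ[ℂ] H) :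
    star (rangeProj U) = rangeProj U := by
  rw [ContinuousLinearMap.star_eq_adjoint, rangeProj, ContinuousLinearMap.adjoint_comp,
    ContinuousLinearMap.adjoint_adjoint]

lemma range_rangeProj (U : EuclideanSpace ℂ (Fin n) →ₗᵢ[ℂ] H) :
    Set.range U = Set.range (rangeProj U) := by
  ext x
  constructor
  · rintro ⟨y, rfl⟩
    exact ⟨U y, rangeProj_apply_self U y⟩
  · rintro ⟨y, rfl⟩
    exact ⟨ContinuousLinearMap.adjoint U.toContinuousLinearMap y, rfl⟩

/-- The off-diagonal corner of an operator is controlled by the failure of multiplicativity of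
the compression. -/
lemma sq_norm_corner_le (U : EuclideanSpace ℂ (Fin n) →ₗᵢ[ℂ] H) (T : H →L[ℂ] H) :
    ‖(1 - rangeProj U) * T * rangeProj U‖ ^ 2 ≤
      ‖compress U.toContinuousLinearMap (star T * T) -
        compress U.toContinuousLinearMap (star T) * compress U.toContinuousLinearMap T‖ := by
  set V := U.toContinuousLinearMap with hV
  set S : EuclideanSpace ℂ (Fin n) →L[ℂ] H := ((1 - rangeProj U) * T) ∘L V with hS
  have hSS : ContinuousLinearMap.adjoint S ∘L S =
      compress V (star T * T) - compress V (star T) * compress V T := by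
    have hq : star (1 - rangeProj U) * (1 - rangeProj U) = 1 - rangeProj U := by
      rw [star_sub, star_one, star_rangeProj, sub_mul, mul_sub, mul_sub, rangeProj_mul_self]
      simp
    have h1 : ContinuousLinearMap.adjoint S ∘L S =
        compress V (star T * (star (1 - rangeProj U) * (1 - rangeProj U)) * T) := by
      rw [hS, ContinuousLinearMap.adjoint_comp, ← ContinuousLinearMap.star_eq_adjoint (_ * _),
        star_mul]
      rfl
    rw [h1, hq, mul_sub, sub_mul, mul_one]
    ext1 x
    simp [compress, rangeProj, hV]
  have hn : ‖S‖ ^ 2 = ‖compress V (star T * T) - compress V (star T) * compress V T‖ := by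
    rw [← hSS, ContinuousLinearMap.norm_adjoint_comp_self, sq]
  rw [← hn]
  have hle : ‖(1 - rangeProj U) * T * rangeProj U‖ ≤ ‖S‖ := by
    have h2 : (1 - rangeProj U) * T * rangeProj U = S ∘L ContinuousLinearMap.adjoint V := rfl
    rw [h2]
    refine (ContinuousLinearMap.opNorm_comp_le _ _).trans ?_
    rw [LinearIsometryEquiv.norm_map]
    exact mul_le_of_le_one_right (norm_nonneg _) U.norm_toContinuousLinearMap_le
  gcongr

lemma norm_commutator_rangeProj_lt (U : EuclideanSpace ℂ (Fin n) →ₗᵢ[ℂ] H) (T : H →L[ℂ] H)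
    {κ : ℝ}
    (h : ‖compress U.toContinuousLinearMap (star T * T) -
        compress U.toContinuousLinearMap (star T) * compress U.toContinuousLinearMap T‖ < κ)
    (h' : ‖compress U.toContinuousLinearMap (T * star T) -
        compress U.toContinuousLinearMap T * compress U.toContinuousLinearMap (star T)‖ < κ) :
    ‖rangeProj U * T - T * rangeProj U‖ < 2 * √κ := by
  have h1 : ‖(1 - rangeProj U) * T * rangeProj U‖ < √κ :=
    (Real.lt_sqrt (norm_nonneg _)).2 ((sq_norm_corner_le U T).trans_lt h)
  have h2 : ‖(1 - rangeProj U) * star T * rangeProj U‖ < √κ := by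
    refine (Real.lt_sqrt (norm_nonneg _)).2 ((sq_norm_corner_le U (star T)).trans_lt ?_)
    rwa [star_star]
  have h3 : rangeProj U * T - T * rangeProj U =
      star ((1 - rangeProj U) * star T * rangeProj U) - (1 - rangeProj U) * T * rangeProj U := by
    simp only [star_mul, star_sub, star_star, star_rangeProj, sub_mul, one_mul, mul_assoc]
    abel
  rw [h3]
  refine (norm_sub_le _ _).trans_lt ?_
  rw [norm_star]
  linarith

end Isometry

/-- a finite-dimensional Voiculescu-type lemma.  Let `A` be a separable
unital C*-algebra, faithfully and isometrically represented (via `ι₀`) on a separable Hilbert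
space `H` with `A ∩ K(H) = {0}`.  Let `X` be a finite self-adjoint subset of the unit ball of
`A`, let `ε, δ > 0`, and let `φ : A → M_n(ℂ)` be a ucp `(X,δ)`-*-homomorphism.  Then there
are a rank-`n` orthogonal projection `p ∈ B(H)` and a unitary isomorphism
`u : ℂⁿ → pH` such that `‖u*(pap)u − φ(a)‖ < ε` and `‖pa − ap‖ < 2√(3ε+δ)` for all
`a ∈ X`. -/
theorem statement7 {A : Type*} [CStarAlgebra A] [TopologicalSpace.SeparableSpace A]
    {H : Type*} [NormedAddCommGroup H] [InnerProductSpace ℂ H] [CompleteSpace H]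
    [TopologicalSpace.SeparableSpace H]
    (ι₀ : A →⋆ₐ[ℂ] (H →L[ℂ] H)) (hι₀ : Isometry ι₀)
    (h_disjoint : ∀ a : A, IsCompactOperator (⇑(ι₀ a)) → a = 0)
    (X : Set A) (hXfin : X.Finite) (hXsa : ∀ x ∈ X, star x ∈ X)
    (hXball : ∀ x ∈ X, ‖x‖ ≤ 1)
    (ε δ : ℝ) (hε : 0 < ε) (hδ : 0 < δ)
    (n : ℕ) (φ : A →ₗ[ℂ] Matrix (Fin n) (Fin n) ℂ) (hφ_ucp : IsUcpToMat φ)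
    (hφ_star : ∀ x ∈ X, ‖φ (star x) - star (φ x)‖ < δ)
    (hφ_mul : ∀ x ∈ X, ∀ y ∈ X, ‖φ (x * y) - φ x * φ y‖ < δ) :
    ∃ (p : H →L[ℂ] H) (u : EuclideanSpace ℂ (Fin n) →ₗᵢ[ℂ] H),
      p * p = p ∧ star p = p ∧
      Set.range u = Set.range p ∧
      (∀ a ∈ X,
        ‖Matrix.of (fun i j : Fin n =>
            ⟪(u (EuclideanSpace.single i 1) : H),
              (p ∘L ι₀ a ∘L p) (u (EuclideanSpace.single j 1))⟫_ℂ) - φ a‖ < ε) ∧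
      ∀ a ∈ X, ‖p * ι₀ a - ι₀ a * p‖ < 2 * Real.sqrt (3 * ε + δ) := by
  classical
  set r := min ε 1 / 2 with hr
  have hr0 : 0 < r := by positivity
  have hrε : r ≤ ε / 2 := by rw [hr]; gcongr; exact min_le_left _ _
  have hr1 : r ≤ 1 / 2 := by rw [hr]; gcongr; exact min_le_right _ _
  let F : Finset A := hXfin.toFinset ∪ hXfin.toFinset.image fun a => star a * a
  obtain ⟨U, hU⟩ := hφ_ucp.exists_isometry_compress_near ι₀ h_disjoint F hr0
  have hUX : ∀ a ∈ X, ‖compress U.toContinuousLinearMap (ι₀ a) -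
      Matrix.toEuclideanCLM (n := Fin n) (𝕜 := ℂ) (φ a)‖ < r := fun a ha =>
    hU a (by simp [F, ha])
  have hUsq : ∀ a ∈ X, ‖compress U.toContinuousLinearMap (ι₀ (star a * a)) -
      Matrix.toEuclideanCLM (n := Fin n) (𝕜 := ℂ) (φ (star a * a))‖ < r := fun a ha =>
    hU _ (Finset.mem_union_right _ (Finset.mem_image.2 ⟨a, by simpa using ha, rfl⟩))
  have hcontr : ∀ a ∈ X, ‖compress U.toContinuousLinearMap (ι₀ a)‖ ≤ 1 := fun a ha =>
    (norm_compress_le U _).trans ((NonUnitalStarAlgHom.norm_apply_le ι₀ a).trans (hXball a ha))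
  have hκ : ∀ a ∈ X, ‖compress U.toContinuousLinearMap (star (ι₀ a) * ι₀ a) -
      compress U.toContinuousLinearMap (star (ι₀ a)) * compress U.toContinuousLinearMap (ι₀ a)‖ <
      3 * ε + δ := fun a ha => by
    have hm : ‖Matrix.toEuclideanCLM (n := Fin n) (𝕜 := ℂ) (φ (star a * a)) -
        Matrix.toEuclideanCLM (n := Fin n) (𝕜 := ℂ) (φ (star a)) *
          Matrix.toEuclideanCLM (n := Fin n) (𝕜 := ℂ) (φ a)‖ < δ := by
      rw [← map_mul, ← map_sub, ← Matrix.cstar_norm_def]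
      exact hφ_mul _ (hXsa a ha) a ha
    rw [← map_star, ← map_mul]
    refine (norm_sub_mul_lt (hUsq a ha) (hUX a ha) (hUX _ (hXsa a ha)) (hcontr a ha)
      (hcontr _ (hXsa a ha)) hm).trans_le ?_
    nlinarith
  refine ⟨rangeProj U, U, rangeProj_mul_self U, star_rangeProj U, range_rangeProj U,
    fun a ha => ?_, fun a ha => norm_commutator_rangeProj_lt U _ (hκ a ha) ?_⟩
  · have hM : (Matrix.of fun i j : Fin n => ⟪(U (EuclideanSpace.single i 1) : H),
        (rangeProj U ∘L ι₀ a ∘L rangeProj U) (U (EuclideanSpace.single j 1))⟫_ℂ) =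
        Matrix.of fun i j : Fin n => ⟪EuclideanSpace.single i (1 : ℂ),
          compress U.toContinuousLinearMap (ι₀ a) (EuclideanSpace.single j 1)⟫_ℂ := by
      ext i j
      rw [Matrix.of_apply, Matrix.of_apply, inner_compress, ContinuousLinearMap.comp_apply,
        ContinuousLinearMap.comp_apply, rangeProj_apply_self,
        ← ContinuousLinearMap.adjoint_inner_left, ← ContinuousLinearMap.star_eq_adjoint,
        star_rangeProj, rangeProj_apply_self]
      rfl
    rw [hM, Matrix.cstar_norm_def, map_sub, toEuclideanCLM_of_inner]
    exact (hUX a ha).trans_le (by linarith)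
  · have := hκ _ (hXsa a ha)
    rwa [map_star, star_star] at this
end
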